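/- arXiv:0802.2111 — 3 statements merged into one kernel-verified Lean document; each statement's English description precedes it below -/
import Mathlib

section
/- Let Φ : ℂ × ℂ → ℂ be continuous and bounded, with Φ(c, w) = 0 whenever |c| ≥ 1, and Lipschitz in the second variable: there is L > 0 with |Φ(c, w) − Φ(c, w′)| ≤ L |w − w′| for all c, w, w′ ∈ ℂ. Then for each z ∈ ℂ there is at most one bounded continuous function f : ℂ → ℂ satisfying the fixed point equation f(c) = z + 𝒦f(c) for all c ∈ ℂ. -/
open MeasureTheory

/-- The operator `𝒦`:
`𝒦 f (c) = -(1/π) ∬_ℂ Φ(ζ, f(ζ))/(ζ - c) dξ dη`. -/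
noncomputable def KOp (Φ : ℂ → ℂ → ℂ) (f : ℂ → ℂ) (c : ℂ) : ℂ :=
  -(Real.pi)⁻¹ • ∫ ζ : ℂ, Φ ζ (f ζ) / (ζ - c)

/-- `u` is measurable, bounded by `B`, and supported in the open unit disc. -/
structure DiscBounded (u : ℂ → ℂ) (B : ℝ) : Prop where
  measurable : Measurable u
  norm_le : ∀ ζ, ‖u ζ‖ ≤ B
  eq_zero : ∀ ζ, 1 ≤ ‖ζ‖ → u ζ = 0

/-- The unnormalised Cauchy transform on the plane. -/
noncomputable def cauchyTransform (u : ℂ → ℂ) (c : ℂ) : ℂ :=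
  ∫ ζ : ℂ, u ζ / (ζ - c)

lemma integrable_norm_inv_mul_exp_neg :
    Integrable (fun x : ℂ => ‖x‖⁻¹ * Real.exp (-‖x‖)) := by
  have h := Complex.integral_rpow_mul_exp_neg_rpow (p := 1) (q := -1) le_rfl (by norm_num)
  simp only [Real.rpow_neg_one, Real.rpow_one] at h
  by_contra hn
  rw [integral_undef hn] at h
  norm_num at h

namespace DiscBounded

lemma nonneg {u : ℂ → ℂ} {B : ℝ} (hu : DiscBounded u B) : 0 ≤ B :=
  (norm_nonneg _).trans (hu.norm_le 0)

lemma mul {u v : ℂ → ℂ} {B M : ℝ} (hu : DiscBounded u B) (hv : Measurable v)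
    (hM : ∀ ζ, ‖v ζ‖ ≤ M) : DiscBounded (fun ζ => u ζ * v ζ) (B * M) where
  measurable := hu.measurable.mul hv
  norm_le ζ := by
    rw [norm_mul]
    exact mul_le_mul (hu.norm_le ζ) (hM ζ) (norm_nonneg _) hu.nonneg
  eq_zero ζ hζ := by simp [hu.eq_zero ζ hζ]

lemma measurable_div_sub {u : ℂ → ℂ} {B : ℝ} (hu : DiscBounded u B) (c : ℂ) :
    Measurable fun ζ => u ζ / (ζ - c) :=
  hu.measurable.div (measurable_id.sub_const c)

end DiscBounded

lemma exists_integral_norm_div_sub_le :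
    ∃ K : ℝ, ∀ (u : ℂ → ℂ) (B : ℝ), DiscBounded u B → ∀ c : ℂ,
      Integrable (fun ζ => u ζ / (ζ - c)) ∧ ∫ ζ, ‖u ζ / (ζ - c)‖ ≤ B * K := by
  set G : ℂ → ℝ := fun x => Real.exp 1 * (‖x‖⁻¹ * Real.exp (-‖x‖)) with hG
  have hGi : Integrable G := integrable_norm_inv_mul_exp_neg.const_mul _
  have hG0 : ∀ x, 0 ≤ G x := fun x => by positivity
  set I : ℂ → ℝ := (Metric.ball (0 : ℂ) 1).indicator 1 with hI
  have hIi : Integrable I := by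
    rw [hI, integrable_indicator_iff Metric.isOpen_ball.measurableSet]
    exact integrableOn_const measure_ball_lt_top.ne
  have hI0 : ∀ x, 0 ≤ I x := fun x => Set.indicator_nonneg (fun _ _ => zero_le_one) x
  refine ⟨(∫ x, G x) + ∫ x, I x, fun u B hu c => ?_⟩
  have hm : Integrable fun ζ => B * (G (ζ - c) + I ζ) :=
    ((hGi.comp_sub_right c).add hIi).const_mul B
  have hle : ∀ ζ, ‖u ζ / (ζ - c)‖ ≤ B * (G (ζ - c) + I ζ) := by
    intro ζ
    rcases le_or_gt 1 ‖ζ‖ with h1 | h1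
    · rw [hu.eq_zero ζ h1]
      simpa using mul_nonneg hu.nonneg (add_nonneg (hG0 _) (hI0 _))
    · rw [norm_div, div_eq_mul_inv]
      refine mul_le_mul (hu.norm_le ζ) ?_ (by positivity) hu.nonneg
      rcases le_or_gt ‖ζ - c‖ 1 with h2 | h2
      · refine le_trans ?_ (le_add_of_nonneg_right (hI0 ζ))
        have : 1 ≤ Real.exp 1 * Real.exp (-‖ζ - c‖) := by
          rw [← Real.exp_add]
          exact Real.one_le_exp (by linarith)
        calc ‖ζ - c‖⁻¹ = ‖ζ - c‖⁻¹ * 1 := (mul_one _).symm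
          _ ≤ ‖ζ - c‖⁻¹ * (Real.exp 1 * Real.exp (-‖ζ - c‖)) := by gcongr
          _ = G (ζ - c) := by simp only [hG]; ring
      · refine le_trans (inv_le_one_of_one_le₀ h2.le) ?_
        have : I ζ = 1 := by simp [hI, h1]
        linarith [hG0 (ζ - c)]
  have hi : Integrable fun ζ => u ζ / (ζ - c) :=
    hm.mono' (hu.measurable_div_sub c).aestronglyMeasurable (Filter.Eventually.of_forall hle)
  refine ⟨hi, (integral_mono hi.norm hm hle).trans_eq ?_⟩
  rw [integral_const_mul, integral_add (hGi.comp_sub_right c) hIi,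
    integral_sub_right_eq_self (μ := volume) G c]

namespace DiscBounded

variable {u v : ℂ → ℂ} {B M : ℝ}

lemma integrable_div_sub (hu : DiscBounded u B) (c : ℂ) :
    Integrable fun ζ => u ζ / (ζ - c) := by
  obtain ⟨K, hK⟩ := exists_integral_norm_div_sub_le
  exact (hK u B hu c).1

lemma measurable_cauchyTransform (hu : DiscBounded u B) : Measurable (cauchyTransform u) := by
  refine (StronglyMeasurable.integral_prod_right (ν := volume)
    (f := fun c ζ : ℂ => u ζ / (ζ - c)) ?_).measurable
  exact ((hu.measurable.comp measurable_snd).div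
    (measurable_snd.sub measurable_fst)).stronglyMeasurable

lemma exists_norm_cauchyTransform_le (hu : DiscBounded u B) :
    ∃ M, ∀ c, ‖cauchyTransform u c‖ ≤ M := by
  obtain ⟨K, hK⟩ := exists_integral_norm_div_sub_le
  exact ⟨B * K, fun c => (norm_integral_le_integral_norm _).trans (hK u B hu c).2⟩

lemma integrable_prod_div_sub (hu : DiscBounded u B) (hv : DiscBounded v M) (c : ℂ) :
    Integrable (Function.uncurry fun ζ ω : ℂ => u ζ / (ζ - c) * (v ω / (ω - ζ)))
      (volume.prod volume) := by
  obtain ⟨K, hK⟩ := exists_integral_norm_div_sub_le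
  have hmeas : Measurable (Function.uncurry fun ζ ω : ℂ => u ζ / (ζ - c) * (v ω / (ω - ζ))) :=
    ((hu.measurable_div_sub c).comp measurable_fst).mul
      ((hv.measurable.comp measurable_snd).div (measurable_snd.sub measurable_fst))
  rw [integrable_prod_iff hmeas.aestronglyMeasurable]
  refine ⟨Filter.Eventually.of_forall fun ζ =>
    (hv.integrable_div_sub ζ).const_mul (u ζ / (ζ - c)), ?_⟩
  refine ((hu.integrable_div_sub c).norm.mul_const (M * K)).mono'
    hmeas.stronglyMeasurable.norm.integral_prod_right'.aestronglyMeasurable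
    (Filter.Eventually.of_forall fun ζ => ?_)
  simp only [Function.uncurry, norm_mul, integral_const_mul]
  rw [norm_norm, Real.norm_of_nonneg (integral_nonneg fun _ => norm_nonneg _)]
  exact mul_le_mul_of_nonneg_left (hK v M hv ζ).2 (norm_nonneg _)

/-- The Cauchy transform is a Rota–Baxter operator of weight zero. -/
lemma cauchyTransform_mul_cauchyTransform (hu : DiscBounded u B) (hv : DiscBounded v M) (c : ℂ) :
    cauchyTransform u c * cauchyTransform v c =
      cauchyTransform (fun ζ => v ζ * cauchyTransform u ζ) c +
        cauchyTransform (fun ζ => u ζ * cauchyTransform v ζ) c := by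
  have h1 := hv.integrable_prod_div_sub hu c
  have h2 := hu.integrable_prod_div_sub hv c
  have hswap : cauchyTransform (fun ζ => u ζ * cauchyTransform v ζ) c =
      ∫ ω, ∫ ζ, u ζ / (ζ - c) * (v ω / (ω - ζ)) := by
    rw [← integral_integral_swap h2]
    refine integral_congr_ae (Filter.Eventually.of_forall fun ζ => ?_)
    simp only [integral_const_mul, cauchyTransform]
    ring
  have hfst : cauchyTransform (fun ζ => v ζ * cauchyTransform u ζ) c =
      ∫ ω, ∫ ζ, v ω / (ω - c) * (u ζ / (ζ - ω)) := by
    refine integral_congr_ae (Filter.Eventually.of_forall fun ζ => ?_)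
    simp only [integral_const_mul, cauchyTransform]
    ring
  have hprod : cauchyTransform u c * cauchyTransform v c =
      ∫ ω, ∫ ζ, u ζ / (ζ - c) * (v ω / (ω - c)) := by
    simp only [integral_mul_const, integral_const_mul, cauchyTransform]
  rw [hswap, hfst, hprod]
  refine Eq.trans ?_ (integral_add h1.integral_prod_left h2.swap.integral_prod_left)
  refine integral_congr_ae ?_
  filter_upwards [h2.swap.prod_right_ae, Measure.ae_ne volume c] with ω h2ω hω
  refine Eq.trans ?_ (integral_add ((hu.integrable_div_sub ω).const_mul (v ω / (ω - c))) h2ω)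
  refine integral_congr_ae ?_
  filter_upwards [Measure.ae_ne volume c, Measure.ae_ne volume ω] with ζ hζ hζω
  have e1 := sub_ne_zero.2 hω
  have e2 := sub_ne_zero.2 hζ
  have e3 := sub_ne_zero.2 hζω
  have e4 := sub_ne_zero.2 hζω.symm
  change _ = v ω / (ω - c) * (u ζ / (ζ - ω)) + u ζ / (ζ - c) * (v ω / (ω - ζ))
  rw [← neg_sub ζ ω]
  field_simp
  ring

end DiscBounded

/-- Finite form of `cauchyTransform (a * exp (-A)) = 1 - exp (-A)` for `A = cauchyTransform a`. -/
lemma cauchyTransform_pow_succ {a : ℂ → ℂ} {B : ℝ} (ha : DiscBounded a B) (n : ℕ) (c : ℂ) :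
    cauchyTransform a c ^ (n + 1) =
      (n + 1) * cauchyTransform (fun ζ => a ζ * cauchyTransform a ζ ^ n) c := by
  obtain ⟨M, hM⟩ := ha.exists_norm_cauchyTransform_le
  induction n generalizing c with
  | zero => simp
  | succ n ih =>
    have hn : DiscBounded (fun ζ => a ζ * cauchyTransform a ζ ^ n) (B * M ^ n) :=
      ha.mul (ha.measurable_cauchyTransform.pow_const n) fun ζ => by
        rw [norm_pow]; exact pow_le_pow_left₀ (norm_nonneg _) (hM ζ) n
    have hn0 : (n : ℂ) + 1 ≠ 0 := by exact_mod_cast n.succ_ne_zero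
    have hT : ∀ ζ, cauchyTransform (fun ζ => a ζ * cauchyTransform a ζ ^ n) ζ =
        ((n : ℂ) + 1)⁻¹ * cauchyTransform a ζ ^ (n + 1) := fun ζ => by
      rw [ih]; field_simp
    have key := ha.cauchyTransform_mul_cauchyTransform hn c
    have e : cauchyTransform (fun ζ => a ζ * (((n : ℂ) + 1)⁻¹ * cauchyTransform a ζ ^ (n + 1))) c =
        ((n : ℂ) + 1)⁻¹ * cauchyTransform (fun ζ => a ζ * cauchyTransform a ζ ^ (n + 1)) c := by
      rw [cauchyTransform, cauchyTransform, ← integral_const_mul]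
      congr 1; ext ζ; ring
    simp only [hT, e, mul_assoc, ← pow_succ] at key
    rw [pow_succ', ← mul_right_inj' (inv_ne_zero hn0), mul_left_comm, key]
    push_cast
    field_simp

lemma eq_zero_of_eq_cauchyTransform_mul {a d : ℂ → ℂ} {B D : ℝ} (ha : DiscBounded a B)
    (hd : Measurable d) (hD : ∀ c, ‖d c‖ ≤ D)
    (h : ∀ c, d c = cauchyTransform (fun ζ => a ζ * d ζ) c) (c : ℂ) : d c = 0 := by
  obtain ⟨K, hK⟩ := exists_integral_norm_div_sub_le
  obtain ⟨M, hM⟩ := ha.exists_norm_cauchyTransform_le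
  have hA := ha.measurable_cauchyTransform
  set A := cauchyTransform a with hAdef
  have hpow : ∀ n ζ, ‖A ζ ^ n‖ ≤ M ^ n := fun n ζ => by
    rw [norm_pow]; exact pow_le_pow_left₀ (norm_nonneg _) (hM ζ) n
  have had := ha.mul hd hD
  have hn (n : ℕ) := ha.mul (hA.pow_const n) (hpow n)
  have hdn (n : ℕ) := had.mul (hA.pow_const n) (hpow n)
  set R : ℕ → ℂ := fun n => cauchyTransform (fun ζ => a ζ * d ζ * A ζ ^ n) c with hR
  have hrec : ∀ n : ℕ, d c * A c ^ (n + 1) = (n + 1) * R n + R (n + 1) := by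
    intro n
    have hn0 : (n : ℂ) + 1 ≠ 0 := by exact_mod_cast n.succ_ne_zero
    have hT : ∀ ζ, cauchyTransform (fun ζ => a ζ * A ζ ^ n) ζ =
        ((n : ℂ) + 1)⁻¹ * A ζ ^ (n + 1) := fun ζ => by
      rw [hAdef, cauchyTransform_pow_succ ha]; field_simp
    have key := had.cauchyTransform_mul_cauchyTransform (hn n) c
    have e1 : cauchyTransform (fun ζ => a ζ * A ζ ^ n * d ζ) c = R n := by
      simp only [hR, mul_right_comm]
    have e2 : cauchyTransform
        (fun ζ => a ζ * d ζ * (((n : ℂ) + 1)⁻¹ * A ζ ^ (n + 1))) c =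
        ((n : ℂ) + 1)⁻¹ * R (n + 1) := by
      simp only [hR, cauchyTransform]
      rw [← integral_const_mul]
      congr 1; ext ζ; ring
    simp only [hT, ← h, e1, e2] at key
    field_simp at key
    linear_combination key
  have hsum : ∀ n : ℕ, ∑ k ∈ Finset.range (n + 1), d c * ((-A c) ^ k / k.factorial) =
      (-1) ^ n * (R n / n.factorial) := by
    intro n
    induction n with
    | zero => simp [hR, ← h]
    | succ n ih =>
      have hn0 : (n : ℂ) + 1 ≠ 0 := by exact_mod_cast n.succ_ne_zero
      have hf0 : (n.factorial : ℂ) ≠ 0 := by exact_mod_cast n.factorial_ne_zero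
      rw [Finset.sum_range_succ, ih, neg_pow, Nat.factorial_succ]
      push_cast
      field_simp
      linear_combination (-1) ^ (n + 1) * hrec n
  have hlim : Filter.Tendsto (fun n : ℕ => (-1) ^ n * (R n / n.factorial))
      Filter.atTop (nhds 0) := by
    have := (FloorSemiring.tendsto_pow_div_factorial_atTop M).const_mul (B * D * K)
    rw [mul_zero] at this
    refine squeeze_zero_norm (fun n => ?_) this
    have hRn : ‖R n‖ ≤ B * D * M ^ n * K :=
      (norm_integral_le_integral_norm _).trans (hK _ _ (hdn n) c).2
    rw [norm_mul, norm_pow, norm_neg, norm_one, one_pow, one_mul, norm_div, Complex.norm_natCast,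
      ← mul_div_assoc]
    gcongr
    linarith
  have hexp := ((NormedSpace.expSeries_div_hasSum_exp (-A c)).mul_left (d c)).tendsto_sum_nat.comp
    (Filter.tendsto_add_atTop_nat 1)
  have h0 := tendsto_nhds_unique (hexp.congr hsum) hlim
  rw [← Complex.exp_eq_exp_ℂ] at h0
  exact (mul_eq_zero.1 h0).resolve_right (Complex.exp_ne_zero _)

/-- If `Φ : ℂ × ℂ → ℂ` is continuous and bounded, vanishes when `|c| ≥ 1`,
and is Lipschitz in the second variable with constant `L > 0`, then for each `z ∈ ℂ`
there is at most one bounded continuous `f : ℂ → ℂ` with `f(c) = z + 𝒦f(c)` for all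
`c ∈ ℂ`. -/
theorem KOp_fixedPoint_unique
    (L : ℝ) (hL : 0 < L) (Φ : ℂ → ℂ → ℂ)
    (hΦcont : Continuous (Function.uncurry Φ))
    (hΦbdd : ∃ C : ℝ, ∀ c w : ℂ, ‖Φ c w‖ ≤ C)
    (hΦsupp : ∀ c w : ℂ, 1 ≤ ‖c‖ → Φ c w = 0)
    (hΦlip : ∀ c w w' : ℂ, ‖Φ c w - Φ c w'‖ ≤ L * ‖w - w'‖)
    (z : ℂ) (f g : ℂ → ℂ)
    (hf : Continuous f) (hfb : ∃ M : ℝ, ∀ c : ℂ, ‖f c‖ ≤ M)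
    (hg : Continuous g) (hgb : ∃ M : ℝ, ∀ c : ℂ, ‖g c‖ ≤ M)
    (hfeq : ∀ c : ℂ, f c = z + KOp Φ f c)
    (hgeq : ∀ c : ℂ, g c = z + KOp Φ g c) :
    f = g := by
  obtain ⟨C, hC⟩ := hΦbdd
  obtain ⟨Mf, hMf⟩ := hfb
  obtain ⟨Mg, hMg⟩ := hgb
  have hu : ∀ k : ℂ → ℂ, Continuous k → DiscBounded (fun ζ => Φ ζ (k ζ)) C := fun k hk =>
    ⟨(hΦcont.comp (continuous_id.prodMk hk)).measurable, fun ζ => hC ζ _, fun ζ => hΦsupp ζ _⟩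
  set a : ℂ → ℂ := fun ζ =>
    -((Real.pi : ℂ)⁻¹) * ((Φ ζ (f ζ) - Φ ζ (g ζ)) / (f ζ - g ζ)) with ha
  have haB : DiscBounded a (Real.pi⁻¹ * L) := by
    refine ⟨(((hu f hf).measurable.sub (hu g hg).measurable).div
      (hf.measurable.sub hg.measurable)).const_mul _, fun ζ => ?_, fun ζ hζ => ?_⟩
    · simp only [ha, norm_mul, norm_neg, norm_inv, Complex.norm_real, norm_div,
        Real.norm_of_nonneg Real.pi_pos.le]
      gcongr
      exact div_le_of_le_mul₀ (norm_nonneg _) hL.le (hΦlip _ _ _)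
    · simp [ha, hΦsupp _ _ hζ]
  have had : ∀ ζ, a ζ * (f ζ - g ζ) = -((Real.pi : ℂ)⁻¹) * (Φ ζ (f ζ) - Φ ζ (g ζ)) := by
    intro ζ
    rcases eq_or_ne (f ζ) (g ζ) with h | h
    · simp [h]
    · simp only [ha, mul_assoc, div_mul_cancel₀ _ (sub_ne_zero.2 h)]
  funext c
  refine sub_eq_zero.1 (eq_zero_of_eq_cauchyTransform_mul haB (d := fun ζ => f ζ - g ζ)
    (D := Mf + Mg) (hf.sub hg).measurable
    (fun ζ => (norm_sub_le _ _).trans (add_le_add (hMf ζ) (hMg ζ))) (fun c => ?_) c)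
  simp only [had, cauchyTransform, mul_div_assoc, sub_div, integral_const_mul]
  rw [integral_sub ((hu f hf).integrable_div_sub c) ((hu g hg).integrable_div_sub c),
    hfeq c, hgeq c]
  simp only [KOp, Complex.real_smul]
  push_cast
  ring
end

section
/- Let E ⊂ ℂ be a finite set and let h : Δ × E → ℂ be a holomorphic motion of E parametrized by Δ with base point 0. Then for every real r with 0 < r < 1 there exists a map H_r : Δ_r × ℂ → ℂ which is a holomorphic motion of ℂ parametrized by the disk Δ_r = {c : |c| < r} with base point 0 (i.e. H_r(0, z) = z for all z; z ↦ H_r(c, z) is injective on ℂ for each c ∈ Δ_r; c ↦ H_r(c, z) is holomorphic on Δ_r for each z) and which satisfies H_r(c, z) = h(c, z) for all (c, z) ∈ Δ_r × E. -/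
/-- `h` is a holomorphic motion of `E ⊆ ℂ` parametrized by the disk `Δ_r = {|c| < r}`
with base point `0`: `h 0 z = z` on `E`; `z ↦ h c z` is injective on `E` for each
`c ∈ Δ_r`; and `c ↦ h c z` is holomorphic on `Δ_r` for each `z ∈ E`. -/
def IsHolomorphicMotion (r : ℝ) (E : Set ℂ) (h : ℂ → ℂ → ℂ) : Prop :=
  (∀ z ∈ E, h 0 z = z) ∧
  (∀ c ∈ Metric.ball (0 : ℂ) r, Set.InjOn (fun z => h c z) E) ∧
  (∀ z ∈ E, DifferentiableOn ℂ (fun c => h c z) (Metric.ball (0 : ℂ) r))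

theorem rotaBaxter_pow {A : Type*} [CommRing A] [Algebra ℂ A] (P : A →ₗ[ℂ] A)
    (hP : ∀ a b, P a * P b = P (a * P b + b * P a)) (a : A) (n : ℕ) :
    P a ^ (n + 1) = ((n : ℂ) + 1) • P (a * P a ^ n) := by
  induction n with
  | zero => simp
  | succ n ih =>
    have h := hP a (a * P a ^ n)
    have hn : (n : ℂ) + 1 ≠ 0 := by exact_mod_cast n.succ_ne_zero
    have h2 : P (a * P a ^ n) = ((n : ℂ) + 1)⁻¹ • P a ^ (n + 1) := by
      rw [ih, smul_smul, inv_mul_cancel₀ hn, one_smul]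
    have h5 : P a ^ (n + 1 + 1) = P a * (((n : ℂ) + 1) • P (a * P a ^ n)) := by
      rw [pow_succ' (P a) (n + 1), ih]
    rw [h5, mul_smul_comm, h, h2]
    have h3 : a * (((n : ℂ) + 1)⁻¹ • P a ^ (n + 1)) + a * P a ^ n * P a
        = (((n : ℂ) + 1)⁻¹ + 1) • (a * P a ^ (n + 1)) := by
      rw [add_smul, one_smul, mul_smul_comm, mul_assoc, ← pow_succ]
    rw [h3, map_smul, smul_smul]
    congr 1
    push_cast
    field_simp
    ring

theorem exp_rotaBaxter {A : Type*} [NormedCommRing A] [NormedAlgebra ℂ A] [CompleteSpace A]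
    (P : A →L[ℂ] A) (hP : ∀ a b, P a * P b = P (a * P b + b * P a)) (a : A) :
    NormedSpace.exp (P a) = 1 + P (a * NormedSpace.exp (P a)) := by
  have h1 := NormedSpace.exp_series_hasSum_exp' (𝕂 := ℂ) (P a)
  have h2 := (h1.mul_left a).mapL P
  have h3 := (hasSum_nat_add_iff' 1).mpr h1
  have h4 : (fun n : ℕ => ((n + 1).factorial : ℂ)⁻¹ • P a ^ (n + 1))
      = fun n : ℕ => P (a * ((n.factorial : ℂ)⁻¹ • P a ^ n)) := by
    funext n
    have hn : (n : ℂ) + 1 ≠ 0 := by exact_mod_cast n.succ_ne_zero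
    have hf : (n.factorial : ℂ) ≠ 0 := by exact_mod_cast n.factorial_ne_zero
    rw [show P a ^ (n + 1) = ((n : ℂ) + 1) • P (a * P a ^ n) from
      rotaBaxter_pow P.toLinearMap hP a n, mul_smul_comm, map_smul, smul_smul, Nat.factorial_succ]
    congr 1
    push_cast
    field_simp
  rw [h4] at h3
  have := h3.unique h2
  rw [← this]
  simp

theorem exp_neg_rotaBaxter_mul {A : Type*} [NormedCommRing A] [NormedAlgebra ℂ A]
    [CompleteSpace A] (P : A →L[ℂ] A) (hP : ∀ a b, P a * P b = P (a * P b + b * P a))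
    (a u : A) (z : ℂ) :
    NormedSpace.exp (-P a) * (algebraMap ℂ A z + P u)
      = algebraMap ℂ A z + P (NormedSpace.exp (-P a) * (u - a * (algebraMap ℂ A z + P u))) := by
  have hE := exp_rotaBaxter P hP (-a)
  rw [map_neg] at hE
  set E := NormedSpace.exp (-P a)
  have h1 : P (a * E) = 1 - E := by
    rw [neg_mul, map_neg] at hE
    nth_rw 2 [hE]
    ring
  have h2 := hP (a * E) u
  rw [h1] at h2
  have h3 : E * (u - a * (algebraMap ℂ A z + P u))
      = u - z • (a * E) - (a * E * P u + u * (1 - E)) := by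
    rw [Algebra.smul_def]; ring
  rw [h3, map_sub, map_sub, ← h2, map_smul, h1, Algebra.smul_def]
  ring

theorem exists_fixedPoint_of_expanding {X : Type*} [NormedAddCommGroup X] [NormedSpace ℝ X]
    [CompleteSpace X] (Ψ : X → X) (M C : ℝ) (hM0 : 0 ≤ M) (hC0 : 0 ≤ C)
    (hM : ∀ u v, ‖Ψ u - Ψ v‖ ≤ M * ‖u - v‖)
    (hC : ∀ t ∈ Set.Icc (0 : ℝ) 1, ∀ u v,
      ‖u - v‖ ≤ C * ‖(u - t • Ψ u) - (v - t • Ψ v)‖) :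
    ∃ u, u = Ψ u := by
  obtain ⟨N, hN⟩ := exists_nat_gt (C * M)
  have hN0 : (0 : ℝ) < N := lt_of_le_of_lt (by positivity) hN
  have key : ∀ n : ℕ, n ≤ N → ∀ v, ∃ u, u - ((n : ℝ) / N) • Ψ u = v := by
    intro n
    induction n with
    | zero => intro _ v; exact ⟨v, by simp⟩
    | succ n ih =>
      intro hn v
      have hs := ih (by omega)
      choose G hG using hs
      have ht : (n : ℝ) / N ∈ Set.Icc (0 : ℝ) 1 := by
        refine ⟨by positivity, (div_le_one hN0).mpr ?_⟩
        exact_mod_cast (by omega : n ≤ N)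
      have hGL : ∀ x y, ‖G x - G y‖ ≤ C * ‖x - y‖ := by
        intro x y
        have := hC _ ht (G x) (G y)
        rwa [hG, hG] at this
      let K : NNReal := ⟨C * M / N, by positivity⟩
      let T : X → X := fun u => G (v + (1 / (N : ℝ)) • Ψ u)
      have hT : ContractingWith K T := by
        refine ⟨?_, LipschitzWith.of_dist_le_mul fun x y => ?_⟩
        · rw [← NNReal.coe_lt_coe]
          exact (div_lt_one hN0).mpr hN
        · rw [dist_eq_norm, dist_eq_norm]
          calc ‖T x - T y‖ ≤ C * ‖(v + (1 / (N : ℝ)) • Ψ x) - (v + (1 / (N : ℝ)) • Ψ y)‖ :=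
                hGL _ _
            _ = C * ((1 / (N : ℝ)) * ‖Ψ x - Ψ y‖) := by
                rw [add_sub_add_left_eq_sub, ← smul_sub, norm_smul, Real.norm_of_nonneg]
                positivity
            _ ≤ C * ((1 / (N : ℝ)) * (M * ‖x - y‖)) := by
                gcongr
                exact hM x y
            _ = C * M / N * ‖x - y‖ := by ring
      have : Nonempty X := ⟨v⟩
      refine ⟨ContractingWith.fixedPoint T hT, ?_⟩
      have hfix : T _ = _ := ContractingWith.fixedPoint_isFixedPt hT
      set u := ContractingWith.fixedPoint T hT
      have h1 := hG (v + (1 / (N : ℝ)) • Ψ u)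
      rw [show G (v + (1 / (N : ℝ)) • Ψ u) = u from hfix] at h1
      have : (((n + 1 : ℕ) : ℝ) / N) = n / N + 1 / N := by push_cast; ring
      rw [this, add_smul, ← sub_sub, h1, add_sub_cancel_right]
  obtain ⟨u, hu⟩ := key N le_rfl 0
  rw [div_self hN0.ne', one_smul] at hu
  exact ⟨u, sub_eq_zero.mp hu⟩

open MeasureTheory Topology

/-- The fundamental solution `1 / (π w)` of the `∂̄` operator. -/
noncomputable def cauchyKernel (w : ℂ) : ℂ := ((Real.pi : ℂ) * w)⁻¹

theorem norm_cauchyKernel (w : ℂ) : ‖cauchyKernel w‖ = Real.pi⁻¹ * ‖w‖⁻¹ := by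
  rw [cauchyKernel, norm_inv, norm_mul, Complex.norm_real, Real.norm_of_nonneg Real.pi_pos.le,
    mul_inv]

theorem measurable_cauchyKernel : Measurable cauchyKernel :=
  (measurable_const.mul measurable_id).inv

theorem locallyIntegrable_cauchyKernel : LocallyIntegrable cauchyKernel := by
  refine locallyIntegrable_of_norm_le_rpow (C := Real.pi⁻¹) (α := 1) ?_ ?_ ?_
    measurable_cauchyKernel.aestronglyMeasurable
  · rw [Complex.finrank_real_complex]; norm_num
  · rw [Complex.finrank_real_complex]; norm_num
  · refine Filter.Eventually.of_forall fun w => ?_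
    rw [norm_cauchyKernel, Real.rpow_neg_one]

theorem cauchyKernel_mul {z a b : ℂ} (ha : a ≠ z) (hb : b ≠ z) (hab : b ≠ a) :
    cauchyKernel (z - a) * cauchyKernel (z - b)
      = cauchyKernel (z - a) * cauchyKernel (a - b)
        + cauchyKernel (z - b) * cauchyKernel (b - a) := by
  have h1 : z - a ≠ 0 := sub_ne_zero.mpr ha.symm
  have h2 : z - b ≠ 0 := sub_ne_zero.mpr hb.symm
  have h3 : a - b ≠ 0 := sub_ne_zero.mpr hab.symm
  have h4 : b - a = -(a - b) := by ring
  have hpi : (Real.pi : ℂ) ≠ 0 := by exact_mod_cast Real.pi_ne_zero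
  simp only [cauchyKernel]
  rw [h4]
  field_simp
  ring

theorem integrable_mul_cauchyKernel {f : ℂ → ℂ} (hf : Continuous f) (hfc : HasCompactSupport f)
    (z : ℂ) : Integrable fun ζ => f ζ * cauchyKernel (z - ζ) :=
  hfc.convolutionExists_left (ContinuousLinearMap.mul ℝ ℂ) hf locallyIntegrable_cauchyKernel z

theorem continuous_integral_mul_cauchyKernel {f : ℂ → ℂ} (hf : Continuous f)
    (hfc : HasCompactSupport f) : Continuous fun z => ∫ ζ, f ζ * cauchyKernel (z - ζ) :=
  hfc.continuous_convolution_left (ContinuousLinearMap.mul ℝ ℂ) hf locallyIntegrable_cauchyKernel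

theorem exists_integral_norm_mul_cauchyKernel_le {f : ℂ → ℂ} (hf : Continuous f)
    (hfc : HasCompactSupport f) :
    ∃ C, 0 ≤ C ∧ ∀ z, ∫ ζ, ‖f ζ * cauchyKernel (z - ζ)‖ ≤ C := by
  obtain ⟨M, hM⟩ := hfc.exists_bound_of_continuous hf
  have hM0 : 0 ≤ M := (norm_nonneg _).trans (hM 0)
  let k : ℂ → ℝ := (Metric.ball (0 : ℂ) 1).indicator fun w => ‖cauchyKernel w‖
  have hk : Integrable k :=
    (integrable_indicator_iff measurableSet_ball).mpr
      ((locallyIntegrable_cauchyKernel.integrableOn_isCompact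
        (isCompact_closedBall (0 : ℂ) 1)).mono_set Metric.ball_subset_closedBall).norm
  have hfi : Integrable fun ζ => ‖f ζ‖ := (hf.integrable_of_hasCompactSupport hfc).norm
  refine ⟨M * (∫ w, k w) + Real.pi⁻¹ * ∫ ζ, ‖f ζ‖, ?_, fun z => ?_⟩
  · have : 0 ≤ ∫ w, k w :=
      integral_nonneg fun w => Set.indicator_nonneg (fun _ _ => norm_nonneg _) w
    have h2 : 0 ≤ ∫ ζ, ‖f ζ‖ := integral_nonneg fun _ => norm_nonneg _
    positivity
  · have hkz : Integrable fun ζ => k (z - ζ) := hk.comp_sub_left z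
    calc ∫ ζ, ‖f ζ * cauchyKernel (z - ζ)‖
        ≤ ∫ ζ, (M * k (z - ζ) + Real.pi⁻¹ * ‖f ζ‖) := by
          refine integral_mono (integrable_mul_cauchyKernel hf hfc z).norm
            ((hkz.const_mul M).add (hfi.const_mul _)) fun ζ => ?_
          simp only [norm_mul]
          by_cases h : z - ζ ∈ Metric.ball (0 : ℂ) 1
          · have : k (z - ζ) = ‖cauchyKernel (z - ζ)‖ := Set.indicator_of_mem h _
            rw [this]
            have h1 := mul_le_mul_of_nonneg_right (hM ζ) (norm_nonneg (cauchyKernel (z - ζ)))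
            have : 0 ≤ Real.pi⁻¹ * ‖f ζ‖ := by positivity
            linarith
          · have : k (z - ζ) = 0 := Set.indicator_of_notMem h _
            rw [this, mul_zero, zero_add, norm_cauchyKernel, mul_comm]
            rw [mem_ball_zero_iff, not_lt] at h
            have : ‖z - ζ‖⁻¹ ≤ 1 := inv_le_one_of_one_le₀ h
            gcongr
            exact mul_le_of_le_one_right (by positivity) this
      _ = _ := by
          rw [integral_add (hkz.const_mul M) (hfi.const_mul _), integral_const_mul,
            integral_const_mul, integral_sub_left_eq_self k volume z]

theorem integrable_prod_cauchyKernel {f g : ℂ → ℂ} (hf : Continuous f) (hfc : HasCompactSupport f)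
    (hg : Continuous g) (hgc : HasCompactSupport g) (z : ℂ) :
    Integrable (fun p : ℂ × ℂ => f p.1 * cauchyKernel (z - p.1) *
      (g p.2 * cauchyKernel (p.1 - p.2)))
      (volume.prod volume) := by
  have hk := measurable_cauchyKernel
  have hm : AEStronglyMeasurable (fun p : ℂ × ℂ => f p.1 * cauchyKernel (z - p.1) *
      (g p.2 * cauchyKernel (p.1 - p.2))) (volume.prod volume) := by
    have hf' := hf.measurable
    have hg' := hg.measurable
    apply Measurable.aestronglyMeasurable
    fun_prop
  obtain ⟨C, hC0, hC⟩ := exists_integral_norm_mul_cauchyKernel_le hg hgc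
  refine (integrable_prod_iff hm).mpr ⟨Filter.Eventually.of_forall fun ζ =>
    (integrable_mul_cauchyKernel hg hgc ζ).const_mul (f ζ * cauchyKernel (z - ζ)), ?_⟩
  refine ((integrable_mul_cauchyKernel hf hfc z).norm.mul_const C).mono'
    hm.norm.integral_prod_right' (Filter.Eventually.of_forall fun ζ => ?_)
  rw [Real.norm_of_nonneg (integral_nonneg fun _ => norm_nonneg _)]
  simp only [norm_mul (f ζ * cauchyKernel (z - ζ))]
  rw [integral_const_mul]
  exact mul_le_mul_of_nonneg_left (hC ζ) (norm_nonneg _)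

theorem integral_cauchyKernel_mul_integral {f g : ℂ → ℂ} (hf : Continuous f)
    (hfc : HasCompactSupport f) (hg : Continuous g) (hgc : HasCompactSupport g) (z : ℂ) :
    (∫ ζ, f ζ * cauchyKernel (z - ζ)) * (∫ η, g η * cauchyKernel (z - η))
      = (∫ ζ, f ζ * (∫ η, g η * cauchyKernel (ζ - η)) * cauchyKernel (z - ζ))
        + ∫ η, g η * (∫ ζ, f ζ * cauchyKernel (η - ζ)) * cauchyKernel (z - η) := by
  have h1 := integrable_prod_cauchyKernel hf hfc hg hgc z
  have h2 := integrable_prod_cauchyKernel hg hgc hf hfc z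
  have h3 : Integrable (Function.uncurry fun ζ η =>
      g η * cauchyKernel (z - η) * (f ζ * cauchyKernel (η - ζ))) (volume.prod volume) := h2.swap
  have e1 : (∫ ζ, f ζ * cauchyKernel (z - ζ)) * (∫ η, g η * cauchyKernel (z - η))
      = ∫ ζ, ∫ η, (f ζ * cauchyKernel (z - ζ) * (g η * cauchyKernel (ζ - η))
        + g η * cauchyKernel (z - η) * (f ζ * cauchyKernel (η - ζ))) := by
    rw [← integral_mul_const]
    refine integral_congr_ae ?_
    filter_upwards [(volume : Measure ℂ).ae_ne z] with ζ hζ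
    rw [← integral_const_mul]
    refine integral_congr_ae ?_
    filter_upwards [(volume : Measure ℂ).ae_ne z, (volume : Measure ℂ).ae_ne ζ] with η hη hηζ
    have := cauchyKernel_mul hζ hη hηζ
    linear_combination f ζ * g η * this
  rw [e1]
  have e2 := integral_integral_add h1 h3
  simp only [Function.uncurry] at e2
  rw [e2]
  congr 1
  · refine integral_congr_ae (Filter.Eventually.of_forall fun ζ => ?_)
    simp only
    rw [integral_const_mul]
    ring
  · rw [integral_integral_swap h3]
    refine integral_congr_ae (Filter.Eventually.of_forall fun η => ?_)
    simp only
    rw [integral_const_mul]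
    ring

theorem differentiableOn_integral_mul_cauchyKernel {f : ℂ → ℂ} (hf : Continuous f)
    (hfc : HasCompactSupport f) {r : ℝ} (h0 : ∀ ζ ∈ Metric.ball (0 : ℂ) r, f ζ = 0) :
    DifferentiableOn ℂ (fun z => ∫ ζ, f ζ * cauchyKernel (z - ζ)) (Metric.ball 0 r) := by
  intro z₀ hz₀
  rw [mem_ball_zero_iff] at hz₀
  set ε := (r - ‖z₀‖) / 2 with hε
  have hε0 : 0 < ε := by rw [hε]; linarith
  have hdist : ∀ ζ, f ζ ≠ 0 → ∀ x ∈ Metric.ball z₀ ε, ε ≤ ‖x - ζ‖ := by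
    intro ζ hζ x hx
    have h1 : r ≤ ‖ζ‖ := by
      by_contra! h
      exact hζ (h0 ζ (by rwa [mem_ball_zero_iff]))
    rw [mem_ball_iff_norm] at hx
    have h2 : ‖ζ‖ ≤ ‖x - ζ‖ + ‖x - z₀‖ + ‖z₀‖ := by
      calc ‖ζ‖ = ‖-(x - ζ) + (x - z₀) + z₀‖ := by congr 1; ring
        _ ≤ ‖-(x - ζ)‖ + ‖x - z₀‖ + ‖z₀‖ := norm_add₃_le
        _ = _ := by rw [norm_neg]
    linarith
  have hpi : (Real.pi : ℂ) ≠ 0 := by exact_mod_cast Real.pi_ne_zero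
  have hk := measurable_cauchyKernel
  have key := hasDerivAt_integral_of_dominated_loc_of_deriv_le (μ := volume)
    (F := fun z ζ => f ζ * cauchyKernel (z - ζ))
    (F' := fun z ζ => f ζ * (-((Real.pi : ℂ) * (z - ζ) ^ 2)⁻¹)) (x₀ := z₀)
    (s := Metric.ball z₀ ε) (bound := fun ζ => ‖f ζ‖ * (Real.pi * ε ^ 2)⁻¹)
    (Metric.ball_mem_nhds _ hε0)
    (Filter.Eventually.of_forall fun z =>
      (integrable_mul_cauchyKernel hf hfc z).aestronglyMeasurable)
    (integrable_mul_cauchyKernel hf hfc z₀)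
    (by
      have hf' := hf.measurable
      apply Measurable.aestronglyMeasurable
      fun_prop)
    (Filter.Eventually.of_forall fun ζ x hx => by
      by_cases hζ : f ζ = 0
      · simp [hζ]
      · have := hdist ζ hζ x hx
        rw [norm_mul, norm_neg, norm_inv, norm_mul, norm_pow, Complex.norm_real,
          Real.norm_of_nonneg Real.pi_pos.le]
        gcongr)
    ((hf.integrable_of_hasCompactSupport hfc).norm.mul_const _)
    (Filter.Eventually.of_forall fun ζ x hx => by
      by_cases hζ : f ζ = 0
      · simpa [hζ] using hasDerivAt_const x (0 : ℂ)
      · have hne : x - ζ ≠ 0 := by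
          intro h
          have := hdist ζ hζ x hx
          rw [h, norm_zero] at this
          linarith
        have h1 : HasDerivAt (fun x : ℂ => (Real.pi : ℂ) * (x - ζ)) (Real.pi : ℂ) x := by
          simpa using ((hasDerivAt_id x).sub_const ζ).const_mul (Real.pi : ℂ)
        have h2 := (h1.inv (mul_ne_zero hpi hne)).const_mul (f ζ)
        refine h2.congr_deriv ?_
        field_simp)
  exact key.2.differentiableAt.differentiableWithinAt

open scoped BoundedContinuousFunction

theorem exists_cauchyOperator {χ : ℂ → ℂ} (hχ : Continuous χ) (hχc : HasCompactSupport χ) :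
    ∃ T : (ℂ →ᵇ ℂ) →L[ℂ] (ℂ →ᵇ ℂ),
      (∀ u z, T u z = ∫ ζ, χ ζ * u ζ * cauchyKernel (z - ζ)) ∧
      ∀ a b, T a * T b = T (a * T b + b * T a) := by
  obtain ⟨C, hC0, hC⟩ := exists_integral_norm_mul_cauchyKernel_le hχ hχc
  have hcont : ∀ u : ℂ →ᵇ ℂ, Continuous fun ζ => χ ζ * u ζ := fun u => hχ.mul u.continuous
  have hcpt : ∀ u : ℂ →ᵇ ℂ, HasCompactSupport fun ζ => χ ζ * u ζ := fun u => hχc.mul_right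
  have h_integrable := fun (u : ℂ →ᵇ ℂ) z => integrable_mul_cauchyKernel (hcont u) (hcpt u) z
  have hbd : ∀ (u : ℂ →ᵇ ℂ) z, ‖∫ ζ, χ ζ * u ζ * cauchyKernel (z - ζ)‖ ≤ C * ‖u‖ := by
    intro u z
    calc ‖∫ ζ, χ ζ * u ζ * cauchyKernel (z - ζ)‖
        ≤ ∫ ζ, ‖χ ζ * cauchyKernel (z - ζ)‖ * ‖u‖ := by
          refine norm_integral_le_of_norm_le
            ((integrable_mul_cauchyKernel hχ hχc z).norm.mul_const _)
            (Filter.Eventually.of_forall fun ζ => ?_)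
          rw [mul_right_comm, norm_mul]
          exact mul_le_mul_of_nonneg_left (u.norm_coe_le_norm ζ) (norm_nonneg _)
      _ = (∫ ζ, ‖χ ζ * cauchyKernel (z - ζ)‖) * ‖u‖ := integral_mul_const _ _
      _ ≤ C * ‖u‖ := mul_le_mul_of_nonneg_right (hC z) (norm_nonneg _)
  let T₀ : (ℂ →ᵇ ℂ) →ₗ[ℂ] (ℂ →ᵇ ℂ) :=
    { toFun := fun u => BoundedContinuousFunction.ofNormedAddCommGroup
        (fun z => ∫ ζ, χ ζ * u ζ * cauchyKernel (z - ζ))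
        (continuous_integral_mul_cauchyKernel (hcont u) (hcpt u)) (C * ‖u‖) (hbd u)
      map_add' := fun u v => by
        ext z
        simp only [BoundedContinuousFunction.coe_ofNormedAddCommGroup,
          BoundedContinuousFunction.coe_add, Pi.add_apply]
        rw [← integral_add (h_integrable u z) (h_integrable v z)]
        congr 1; funext ζ; ring
      map_smul' := fun c u => by
        ext z
        simp only [BoundedContinuousFunction.coe_ofNormedAddCommGroup,
          BoundedContinuousFunction.coe_smul, RingHom.id_apply, smul_eq_mul]
        rw [← integral_const_mul]
        congr 1; funext ζ; ring }
  let T : (ℂ →ᵇ ℂ) →L[ℂ] (ℂ →ᵇ ℂ) := T₀.mkContinuous C fun u =>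
    BoundedContinuousFunction.norm_ofNormedAddCommGroup_le _ (by positivity) (hbd u)
  have hT : ∀ u z, T u z = ∫ ζ, χ ζ * u ζ * cauchyKernel (z - ζ) := fun u z => rfl
  refine ⟨T, hT, fun a b => ?_⟩
  ext z
  rw [BoundedContinuousFunction.mul_apply, map_add, BoundedContinuousFunction.add_apply]
  simp only [hT, BoundedContinuousFunction.mul_apply]
  rw [integral_cauchyKernel_mul_integral (hcont a) (hcpt a) (hcont b) (hcpt b) z]
  simp only [mul_assoc]

theorem exists_normalized_cauchyOperator {χ : ℂ → ℂ} (hχ : Continuous χ)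
    (hχc : HasCompactSupport χ) :
    ∃ P : (ℂ →ᵇ ℂ) →L[ℂ] (ℂ →ᵇ ℂ),
      (∀ u z, P u z = (∫ ζ, χ ζ * u ζ * cauchyKernel (z - ζ))
        - ∫ ζ, χ ζ * u ζ * cauchyKernel (0 - ζ)) ∧
      ∀ a b, P a * P b = P (a * P b + b * P a) := by
  obtain ⟨T, hT, hRB⟩ := exists_cauchyOperator hχ hχc
  let P : (ℂ →ᵇ ℂ) →L[ℂ] (ℂ →ᵇ ℂ) := T - (ContinuousLinearMap.toSpanSingleton ℂ (1 : ℂ →ᵇ ℂ)) ∘L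
    (BoundedContinuousFunction.evalCLM ℂ (0 : ℂ)) ∘L T
  have hP : ∀ u, P u = T u - (T u 0) • (1 : ℂ →ᵇ ℂ) := fun u => rfl
  refine ⟨P, fun u z => ?_, fun a b => ?_⟩
  · rw [hP, ← hT, ← hT]
    simp
  · have h1 : a * P b + b * P a = (a * T b + b * T a) - T b 0 • a - T a 0 • b := by
      rw [hP, hP, mul_sub, mul_sub, mul_smul_comm, mul_smul_comm, mul_one, mul_one]
      abel
    have h2 : P (a * T b + b * T a) = T a * T b - (T a 0 * T b 0) • (1 : ℂ →ᵇ ℂ) := by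
      rw [hP, ← hRB]; rfl
    rw [h1, map_sub, map_sub, map_smul, map_smul, h2]
    ext z
    simp [hP]
    ring

/-- The Wirtinger derivative `∂ψ/∂ζ̄`. -/
noncomputable def dbar (ψ : ℂ → ℂ) (ζ : ℂ) : ℂ :=
  (1 / 2) * (fderiv ℝ ψ ζ 1 + Complex.I * fderiv ℝ ψ ζ Complex.I)

theorem integral_dbar_mul_cauchyKernel {ψ : ℂ → ℂ} (hψ : ContDiff ℝ 1 ψ)
    (hψc : HasCompactSupport ψ) (z : ℂ) :
    ∫ ζ, dbar ψ ζ * cauchyKernel (z - ζ) = ψ z := by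
  let u : ℝ → ℂ := fun θ => Real.cos θ + Real.sin θ * Complex.I
  have hu : Continuous u := by fun_prop
  have hu' : ∀ θ, HasDerivAt u (Complex.I * u θ) θ := by
    intro θ
    have h1 := (Real.hasDerivAt_cos θ).ofReal_comp
    have h2 := (Real.hasDerivAt_sin θ).ofReal_comp.mul_const Complex.I
    refine (h1.add h2).congr_deriv ?_
    simp only [u, mul_add]
    rw [mul_left_comm, Complex.I_mul_I]
    push_cast
    ring
  have hun : ∀ θ, ‖u θ‖ = 1 := by
    intro θ
    have : u θ = Complex.exp (θ * Complex.I) := by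
      rw [Complex.exp_mul_I]; simp [u]
    rw [this, Complex.norm_exp_ofReal_mul_I]
  have hu0 : ∀ θ, u θ ≠ 0 := fun θ h => by simpa [h] using hun θ
  have hD : Continuous fun ζ => fderiv ℝ ψ ζ := hψ.continuous_fderiv one_ne_zero
  have hd : Differentiable ℝ ψ := hψ.differentiable one_ne_zero
  obtain ⟨R, hR⟩ : ∃ R, ∀ w, R < ‖w‖ → ψ (z + w) = 0 ∧ fderiv ℝ ψ (z + w) = 0 := by
    obtain ⟨R, hR⟩ := hψc.isBounded.subset_closedBall z
    refine ⟨R, fun w hw => ?_⟩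
    have : z + w ∉ tsupport ψ := fun h => by
      have := hR h
      rw [mem_closedBall_iff_norm, add_sub_cancel_left] at this
      linarith
    exact ⟨image_eq_zero_of_notMem_tsupport this,
      image_eq_zero_of_notMem_tsupport fun h => this (tsupport_fderiv_subset ℝ h)⟩
  let F₁ : ℝ × ℝ → ℂ := fun p => fderiv ℝ ψ (z + p.1 * u p.2) (u p.2)
  let F₂ : ℝ × ℝ → ℂ := fun p => fderiv ℝ ψ (z + p.1 * u p.2) (Complex.I * u p.2)
  have hF₁ : Continuous F₁ := by
    refine (hD.comp ?_).clm_apply ?_ <;> fun_prop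
  have hF₂ : Continuous F₂ := by
    refine (hD.comp ?_).clm_apply ?_ <;> fun_prop
  have hzero : ∀ r θ, 0 < r → R < r → fderiv ℝ ψ (z + (r : ℂ) * u θ) = 0 := by
    intro r θ h0 h
    refine (hR _ ?_).2
    rwa [norm_mul, hun, mul_one, Complex.norm_real, Real.norm_of_nonneg h0.le]
  have hI : ∀ F : ℝ × ℝ → ℂ, Continuous F → (∀ p : ℝ × ℝ, 0 < p.1 → R < p.1 → F p = 0) →
      IntegrableOn F (Set.Ioi (0 : ℝ) ×ˢ Set.Ioo (-Real.pi) Real.pi) := by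
    intro F hF h0
    refine (hF.continuousOn.integrableOn_compact
      ((isCompact_Icc (a := (0 : ℝ)) (b := R)).prod
        (isCompact_Icc (a := -Real.pi) (b := Real.pi)))).of_forall_sdiff_eq_zero
      (measurableSet_Ioi.prod measurableSet_Ioo) ?_
    rintro ⟨r, θ⟩ ⟨⟨h1, h2⟩, h3⟩
    refine h0 _ h1 ?_
    by_contra! h4
    exact h3 ⟨⟨(Set.mem_Ioi.mp h1).le, h4⟩, Set.Ioo_subset_Icc_self h2⟩
  have hI₁ := hI F₁ hF₁ fun p h h' => by simp [F₁, hzero p.1 p.2 h h']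
  have hI₂ := hI F₂ hF₂ fun p h h' => by simp [F₂, hzero p.1 p.2 h h']
  have hJ₁ : ∫ p in Set.Ioi (0 : ℝ) ×ˢ Set.Ioo (-Real.pi) Real.pi, F₁ p
      = -(2 * Real.pi) * ψ z := by
    have hinner : ∀ θ, ∫ r in Set.Ioi (0 : ℝ), F₁ (r, θ) = -ψ z := by
      intro θ
      have hder : ∀ r : ℝ, HasDerivAt (fun r : ℝ => ψ (z + r * u θ)) (F₁ (r, θ)) r := by
        intro r
        have h1 : HasDerivAt (fun r : ℝ => z + (r : ℂ) * u θ) (u θ) r := by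
          simpa using ((hasDerivAt_id r).ofReal_comp.mul_const (u θ)).const_add z
        exact (hd _).hasFDerivAt.comp_hasDerivAt r h1
      have h_integrable : IntegrableOn (fun r => F₁ (r, θ)) (Set.Ioi 0) := by
        have hc : Continuous fun r => F₁ (r, θ) := by fun_prop
        refine (hc.continuousOn.integrableOn_compact
          (isCompact_Icc (a := (0 : ℝ)) (b := R))).of_forall_sdiff_eq_zero measurableSet_Ioi ?_
        rintro r ⟨h1, h3⟩
        have : R < r := by
          by_contra! h4
          exact h3 ⟨(Set.mem_Ioi.mp h1).le, h4⟩
        simp [F₁, hzero r θ h1 this]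
      have hlim : Filter.Tendsto (fun r : ℝ => ψ (z + r * u θ)) Filter.atTop (𝓝 0) := by
        refine tendsto_const_nhds.congr' ?_
        filter_upwards [Filter.eventually_gt_atTop R, Filter.eventually_gt_atTop 0] with r h1 h2
        refine ((hR _ ?_).1).symm
        rwa [norm_mul, hun, mul_one, Complex.norm_real, Real.norm_of_nonneg h2.le]
      rw [integral_Ioi_of_hasDerivAt_of_tendsto' (fun r _ => hder r) h_integrable hlim]
      simp
    rw [Measure.volume_eq_prod, ← setIntegral_prod_swap, setIntegral_prod]
    · simp only [Prod.swap]
      simp_rw [hinner]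
      rw [setIntegral_const, measureReal_def, Real.volume_Ioo, ENNReal.toReal_ofReal
        (by linarith [Real.pi_pos])]
      rw [Complex.real_smul]
      push_cast
      ring
    · exact hI₁.swap
  have hJ₂ : ∫ p in Set.Ioi (0 : ℝ) ×ˢ Set.Ioo (-Real.pi) Real.pi, F₂ p = 0 := by
    rw [Measure.volume_eq_prod, setIntegral_prod _ hI₂]
    refine (setIntegral_congr_fun measurableSet_Ioi fun r hr => ?_).trans (integral_zero ℝ ℂ)
    have hr0 : (r : ℂ) ≠ 0 := by exact_mod_cast (Set.mem_Ioi.mp hr).ne'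
    have hder : ∀ θ : ℝ, HasDerivAt (fun θ : ℝ => ψ (z + r * u θ)) (r * F₂ (r, θ)) θ := by
      intro θ
      have h1 : HasDerivAt (fun θ : ℝ => z + (r : ℂ) * u θ) (r * (Complex.I * u θ)) θ :=
        ((hu' θ).const_mul (r : ℂ)).const_add z
      refine ((hd _).hasFDerivAt.comp_hasDerivAt θ h1).congr_deriv ?_
      simp only [F₂]
      rw [← Complex.real_smul, ← Complex.real_smul, ← Complex.real_smul, map_smul]
    have hpi : -Real.pi ≤ Real.pi := by linarith [Real.pi_pos]
    have h1 := intervalIntegral.integral_eq_sub_of_hasDerivAt (a := -Real.pi) (b := Real.pi)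
      (fun θ _ => hder θ) (Continuous.intervalIntegrable (by fun_prop) _ _)
    have h2 : u Real.pi = u (-Real.pi) := by simp [u]
    rw [h2, sub_self, intervalIntegral.integral_const_mul, mul_eq_zero] at h1
    have h3 := h1.resolve_left hr0
    rw [intervalIntegral.integral_of_le hpi, integral_Ioc_eq_integral_Ioo] at h3
    exact h3
  rw [← integral_add_left_eq_self _ z, ← Complex.integral_comp_polarCoord_symm]
  have hpi : (Real.pi : ℂ) ≠ 0 := by exact_mod_cast Real.pi_ne_zero
  calc _ = ∫ p in Set.Ioi (0 : ℝ) ×ˢ Set.Ioo (-Real.pi) Real.pi,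
        (-(2 * (Real.pi : ℂ))⁻¹) * (F₁ p + Complex.I * F₂ p) := by
        rw [polarCoord_target]
        refine setIntegral_congr_fun (measurableSet_Ioi.prod measurableSet_Ioo) ?_
        rintro ⟨r, θ⟩ ⟨hr, -⟩
        have hr0 : (r : ℂ) ≠ 0 := by exact_mod_cast (Set.mem_Ioi.mp hr).ne'
        have e1 : Complex.polarCoord.symm (r, θ) = r * u θ := by
          simp [Complex.polarCoord_symm_apply, u]
        have hI2 := Complex.I_mul_I
        have lin : ∀ x y : ℝ, fderiv ℝ ψ (z + r * u θ) (x + y * Complex.I)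
            = x * fderiv ℝ ψ (z + r * u θ) 1 + y * fderiv ℝ ψ (z + r * u θ) Complex.I := by
          intro x y
          have : (x + y * Complex.I : ℂ) = x • (1 : ℂ) + y • Complex.I := by simp
          rw [this, map_add, map_smul, map_smul, Complex.real_smul, Complex.real_smul]
        have e2 : Complex.I * u θ = ((-Real.sin θ : ℝ) : ℂ) + (Real.cos θ : ℝ) * Complex.I := by
          simp only [u]
          push_cast
          linear_combination (Complex.sin θ) * hI2
        have e3 : F₁ (r, θ) + Complex.I * F₂ (r, θ)
            = (Real.cos θ - Real.sin θ * Complex.I) * (2 * dbar ψ (z + r * u θ)) := by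
          have hu1 : fderiv ℝ ψ (z + r * u θ) (u θ) = (Real.cos θ : ℝ) * fderiv ℝ ψ (z + r * u θ) 1
              + (Real.sin θ : ℝ) * fderiv ℝ ψ (z + r * u θ) Complex.I := lin _ _
          simp only [F₁, F₂, e2, dbar]
          rw [hu1, lin]
          generalize fderiv ℝ ψ (z + r * u θ) 1 = A
          generalize fderiv ℝ ψ (z + r * u θ) Complex.I = B
          push_cast
          linear_combination (Complex.sin θ * B) * hI2
        have e4 : (Real.cos θ - Real.sin θ * Complex.I) * u θ = 1 := by
          have := Complex.cos_sq_add_sin_sq (θ : ℂ)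
          simp only [u]
          push_cast
          linear_combination this - Complex.sin θ ^ 2 * hI2
        simp only [e1, e3, cauchyKernel]
        have e5 : (Real.cos θ - Real.sin θ * Complex.I : ℂ) = (u θ)⁻¹ :=
          eq_inv_of_mul_eq_one_left e4
        rw [e5, Complex.real_smul, show z - (z + r * u θ) = -(r * u θ) by ring]
        have := hu0 θ
        field_simp
    _ = ψ z := by
        rw [integral_const_mul, integral_add hI₁ (hI₂.const_mul _), integral_const_mul, hJ₁, hJ₂]
        field_simp
        ring

theorem norm_normedSpaceExp_le {A : Type*} [NormedCommRing A] [NormOneClass A] [NormedAlgebra ℂ A]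
    [CompleteSpace A] (x : A) : ‖NormedSpace.exp x‖ ≤ Real.exp ‖x‖ := by
  rw [Real.exp_eq_exp_ℝ, ← (NormedSpace.exp_series_hasSum_exp' (𝕂 := ℂ) x).tsum_eq]
  refine tsum_of_norm_bounded (NormedSpace.exp_series_hasSum_exp' (𝕂 := ℝ) ‖x‖) fun n => ?_
  rw [norm_smul, norm_inv, Complex.norm_natCast, smul_eq_mul]
  gcongr
  exact norm_pow_le x n

theorem exp_mul_exp_neg_eq_one {A : Type*} [NormedCommRing A] [NormedAlgebra ℂ A]
    [CompleteSpace A] (x : A) : NormedSpace.exp x * NormedSpace.exp (-x) = 1 := by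
  let := NormedAlgebra.restrictScalars ℚ ℂ A
  rw [← NormedSpace.exp_add, add_neg_cancel, NormedSpace.exp_zero]

theorem exists_integratingFactor (P : (ℂ →ᵇ ℂ) →L[ℂ] (ℂ →ᵇ ℂ))
    (hP : ∀ a b, P a * P b = P (a * P b + b * P a)) {L : ℝ} (hL : 0 ≤ L) {z : ℂ}
    {u e : ℂ →ᵇ ℂ} (hu : ∀ c, ‖u c - e c‖ ≤ L * ‖z + P u c‖) {s : ℝ} (hs : 0 < s) :
    ∃ E E' : ℂ →ᵇ ℂ, E' * E = 1 ∧ ‖E‖ ≤ Real.exp (‖P‖ * L) ∧ ‖E'‖ ≤ Real.exp (‖P‖ * L) ∧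
      ‖E * (algebraMap ℂ _ z + P u) - algebraMap ℂ _ z‖
        ≤ ‖P‖ * (Real.exp (‖P‖ * L) * (‖e‖ + L * s)) := by
  set G : ℂ →ᵇ ℂ := algebraMap ℂ _ z + P u with hG
  have hGc : ∀ c, z + P u c = G c := fun c => by simp [hG]
  simp only [hGc] at hu
  have hden : ∀ c, 0 < ‖G c‖ ^ 2 + s ^ 2 := fun c => by positivity
  let α : ℂ → ℂ := fun c => (u c - e c) * (starRingEnd ℂ (G c)) * ((‖G c‖ ^ 2 + s ^ 2 : ℝ) : ℂ)⁻¹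
  have hα : Continuous α := by
    refine Continuous.mul (by fun_prop) (Continuous.inv₀ (by fun_prop) fun c => ?_)
    exact_mod_cast (hden c).ne'
  have hαL : ∀ c, ‖α c‖ ≤ L := by
    intro c
    simp only [α]
    rw [norm_mul, norm_mul, norm_inv, RCLike.norm_conj, Complex.norm_real,
      Real.norm_of_nonneg (hden c).le, ← div_eq_mul_inv, div_le_iff₀ (hden c)]
    have h1 := mul_le_mul_of_nonneg_right (hu c) (norm_nonneg (G c))
    have h2 : 0 ≤ L * s ^ 2 := by positivity
    nlinarith
  let a : ℂ →ᵇ ℂ := BoundedContinuousFunction.ofNormedAddCommGroup α hα L hαL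
  have ha : ‖a‖ ≤ L := BoundedContinuousFunction.norm_ofNormedAddCommGroup_le _ hL hαL
  have hPa : ‖P a‖ ≤ ‖P‖ * L := P.le_of_opNorm_le_of_le le_rfl ha
  have hres : ‖u - a * G‖ ≤ ‖e‖ + L * s := by
    refine (BoundedContinuousFunction.norm_le (by positivity)).mpr fun c => ?_
    have h1 : (u - a * G) c = e c + (u c - e c) * ((s ^ 2 / (‖G c‖ ^ 2 + s ^ 2) : ℝ) : ℂ) := by
      have h2 : a c = α c := rfl
      have h3 : ((‖G c‖ ^ 2 + s ^ 2 : ℝ) : ℂ) ≠ 0 := by exact_mod_cast (hden c).ne'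
      have h4 : starRingEnd ℂ (G c) * G c = ((‖G c‖ ^ 2 : ℝ) : ℂ) := by
        rw [mul_comm, Complex.mul_conj, Complex.normSq_eq_norm_sq]
      rw [BoundedContinuousFunction.sub_apply, BoundedContinuousFunction.mul_apply, h2]
      simp only [α]
      rw [Complex.ofReal_div]
      field_simp
      rw [Complex.ofReal_add] at *
      linear_combination (e c - u c) * h4
    rw [h1]
    refine (norm_add_le _ _).trans (add_le_add (e.norm_coe_le_norm c) ?_)
    rw [norm_mul, Complex.norm_real, Real.norm_of_nonneg (div_nonneg (sq_nonneg _) (hden c).le)]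
    calc ‖u c - e c‖ * (s ^ 2 / (‖G c‖ ^ 2 + s ^ 2))
        ≤ L * ‖G c‖ * (s ^ 2 / (‖G c‖ ^ 2 + s ^ 2)) :=
          mul_le_mul_of_nonneg_right (hu c) (div_nonneg (sq_nonneg _) (hden c).le)
      _ = L * s * (‖G c‖ * s / (‖G c‖ ^ 2 + s ^ 2)) := by ring
      _ ≤ L * s * 1 := by
          gcongr
          rw [div_le_one (hden c)]
          nlinarith [sq_nonneg (‖G c‖ - s), sq_nonneg (‖G c‖), sq_nonneg s]
      _ = L * s := mul_one _
  have hE : ‖NormedSpace.exp (-P a)‖ ≤ Real.exp (‖P‖ * L) :=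
    (norm_normedSpaceExp_le _).trans (Real.exp_le_exp.mpr (by rwa [norm_neg]))
  refine ⟨NormedSpace.exp (-P a), NormedSpace.exp (P a), exp_mul_exp_neg_eq_one _, hE,
    (norm_normedSpaceExp_le _).trans (Real.exp_le_exp.mpr hPa), ?_⟩
  rw [hG, exp_neg_rotaBaxter_mul P hP, add_sub_cancel_left]
  refine P.le_of_opNorm_le_of_le le_rfl ((norm_mul_le _ _).trans ?_)
  gcongr

theorem norm_apply_le_of_norm_sub_le (P : (ℂ →ᵇ ℂ) →L[ℂ] (ℂ →ᵇ ℂ))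
    (hP : ∀ a b, P a * P b = P (a * P b + b * P a)) {L : ℝ} (hL : 0 ≤ L)
    {u e : ℂ →ᵇ ℂ} (hu : ∀ c, ‖u c - e c‖ ≤ L * ‖P u c‖) :
    ‖P u‖ ≤ Real.exp (‖P‖ * L) * (‖P‖ * (Real.exp (‖P‖ * L) * ‖e‖)) := by
  have key : ∀ s : ℝ, 0 < s →
      ‖P u‖ ≤ Real.exp (‖P‖ * L) * (‖P‖ * (Real.exp (‖P‖ * L) * (‖e‖ + L * s))) := by
    intro s hs
    obtain ⟨E, E', h1, -, h3, h4⟩ := exists_integratingFactor P hP hL (z := 0)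
      (by simpa using hu) hs
    rw [map_zero, zero_add, sub_zero] at h4
    calc ‖P u‖ = ‖E' * (E * P u)‖ := by rw [← mul_assoc, h1, one_mul]
      _ ≤ ‖E'‖ * ‖E * P u‖ := norm_mul_le _ _
      _ ≤ _ := by gcongr
  have hlim : Filter.Tendsto (fun s : ℝ =>
      Real.exp (‖P‖ * L) * (‖P‖ * (Real.exp (‖P‖ * L) * (‖e‖ + L * s)))) (𝓝[>] 0)
      (𝓝 (Real.exp (‖P‖ * L) * (‖P‖ * (Real.exp (‖P‖ * L) * (‖e‖ + L * 0))))) :=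
    (Continuous.tendsto (by fun_prop) 0).mono_left nhdsWithin_le_nhds
  rw [mul_zero, add_zero] at hlim
  exact ge_of_tendsto hlim (by filter_upwards [self_mem_nhdsWithin] with s hs using key s hs)

theorem norm_const_le_of_norm_le (P : (ℂ →ᵇ ℂ) →L[ℂ] (ℂ →ᵇ ℂ))
    (hP : ∀ a b, P a * P b = P (a * P b + b * P a)) {L : ℝ} (hL : 0 ≤ L)
    {z : ℂ} {u : ℂ →ᵇ ℂ} (hu : ∀ c, ‖u c‖ ≤ L * ‖z + P u c‖) (c : ℂ) :
    ‖z‖ ≤ Real.exp (‖P‖ * L) * ‖z + P u c‖ := by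
  have key : ∀ s : ℝ, 0 < s → ‖z‖ ≤ Real.exp (‖P‖ * L) * ‖z + P u c‖
      + ‖P‖ * (Real.exp (‖P‖ * L) * (L * s)) := by
    intro s hs
    obtain ⟨E, E', -, h2, -, h4⟩ := exists_integratingFactor P hP hL (z := z) (e := 0)
      (by simpa using hu) hs
    rw [norm_zero, zero_add] at h4
    have h5 := (BoundedContinuousFunction.norm_coe_le_norm _ c).trans h4
    have h6 : (E * (algebraMap ℂ (ℂ →ᵇ ℂ) z + P u) - algebraMap ℂ (ℂ →ᵇ ℂ) z) c
        = E c * (z + P u c) - z := by simp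
    rw [h6] at h5
    calc ‖z‖ = ‖E c * (z + P u c) - (E c * (z + P u c) - z)‖ := by congr 1; ring
      _ ≤ ‖E c * (z + P u c)‖ + ‖E c * (z + P u c) - z‖ := norm_sub_le _ _
      _ ≤ _ := by
        rw [norm_mul]
        have := (E.norm_coe_le_norm c).trans h2
        gcongr
  have hlim : Filter.Tendsto (fun s : ℝ => Real.exp (‖P‖ * L) * ‖z + P u c‖
      + ‖P‖ * (Real.exp (‖P‖ * L) * (L * s))) (𝓝[>] 0)
      (𝓝 (Real.exp (‖P‖ * L) * ‖z + P u c‖ + ‖P‖ * (Real.exp (‖P‖ * L) * (L * 0)))) :=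
    (Continuous.tendsto (by fun_prop) 0).mono_left nhdsWithin_le_nhds
  rw [mul_zero, mul_zero, mul_zero, add_zero] at hlim
  exact ge_of_tendsto hlim (by filter_upwards [self_mem_nhdsWithin] with s hs using key s hs)

theorem exists_eq_comp_const_add (P : (ℂ →ᵇ ℂ) →L[ℂ] (ℂ →ᵇ ℂ))
    (hP : ∀ a b, P a * P b = P (a * P b + b * P a)) {L : ℝ} (hL : 0 ≤ L)
    (S : (ℂ →ᵇ ℂ) → (ℂ →ᵇ ℂ)) (hS : ∀ f g c, ‖S f c - S g c‖ ≤ L * ‖f c - g c‖) (z : ℂ) :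
    ∃ u, u = S (algebraMap ℂ _ z + P u) := by
  set Q := Real.exp (‖P‖ * L) with hQ
  have hQ0 : 0 < Q := Real.exp_pos _
  have hdiff : ∀ (u v : ℂ →ᵇ ℂ) c, (algebraMap ℂ (ℂ →ᵇ ℂ) z + P u) c
      - (algebraMap ℂ (ℂ →ᵇ ℂ) z + P v) c = P (u - v) c := by
    intro u v c
    rw [map_sub]
    simp
  refine exists_fixedPoint_of_expanding (fun u => S (algebraMap ℂ _ z + P u)) (L * ‖P‖)
    (1 + L * (Q * (‖P‖ * Q))) (by positivity) (by positivity) (fun u v => ?_) fun t ht u v => ?_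
  · refine (BoundedContinuousFunction.norm_le (by positivity)).mpr fun c => ?_
    refine (hS _ _ c).trans ?_
    rw [hdiff, mul_assoc]
    gcongr
    exact ((P (u - v)).norm_coe_le_norm c).trans (P.le_opNorm _)
  · set f := algebraMap ℂ (ℂ →ᵇ ℂ) z + P u
    set g := algebraMap ℂ (ℂ →ᵇ ℂ) z + P v
    set e := (u - t • S f) - (v - t • S g) with he
    have h1 : ∀ c, ‖(u - v) c - e c‖ ≤ L * ‖P (u - v) c‖ := by
      intro c
      have : (u - v) c - e c = t • (S f c - S g c) := by
        simp [he]
        ring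
      rw [this, norm_smul, Real.norm_of_nonneg ht.1, ← hdiff]
      exact (mul_le_of_le_one_left (norm_nonneg _) ht.2).trans (hS f g c)
    have h2 := norm_apply_le_of_norm_sub_le P hP hL h1
    refine (BoundedContinuousFunction.norm_le (by positivity)).mpr fun c => ?_
    calc ‖(u - v) c‖ = ‖e c + ((u - v) c - e c)‖ := by rw [add_sub_cancel]
      _ ≤ ‖e c‖ + ‖(u - v) c - e c‖ := norm_add_le _ _
      _ ≤ ‖e‖ + L * (Q * (‖P‖ * (Q * ‖e‖))) := by
          refine add_le_add (e.norm_coe_le_norm c) ((h1 c).trans ?_)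
          gcongr
          exact ((P (u - v)).norm_coe_le_norm c).trans h2
      _ = _ := by ring

theorem operator_eq_of_solutions (P : (ℂ →ᵇ ℂ) →L[ℂ] (ℂ →ᵇ ℂ))
    (hP : ∀ a b, P a * P b = P (a * P b + b * P a)) {L : ℝ} (hL : 0 ≤ L)
    {S : (ℂ →ᵇ ℂ) → (ℂ →ᵇ ℂ)} (hS : ∀ f g c, ‖S f c - S g c‖ ≤ L * ‖f c - g c‖)
    {z : ℂ} {u v : ℂ →ᵇ ℂ} (hu : u = S (algebraMap ℂ _ z + P u))
    (hv : v = S (algebraMap ℂ _ z + P v)) : P u = P v := by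
  have h1 : ∀ c, ‖(u - v) c - (0 : ℂ →ᵇ ℂ) c‖ ≤ L * ‖P (u - v) c‖ := by
    intro c
    have h2 := hS (algebraMap ℂ _ z + P u) (algebraMap ℂ _ z + P v) c
    rw [← hu, ← hv] at h2
    simpa using h2
  have h3 := norm_apply_le_of_norm_sub_le P hP hL h1
  rw [norm_zero, mul_zero, mul_zero, mul_zero, norm_le_zero_iff, map_sub, sub_eq_zero] at h3
  exact h3

theorem eq_of_solutions_meet (P : (ℂ →ᵇ ℂ) →L[ℂ] (ℂ →ᵇ ℂ))
    (hP : ∀ a b, P a * P b = P (a * P b + b * P a)) {L : ℝ} (hL : 0 ≤ L)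
    {S : (ℂ →ᵇ ℂ) → (ℂ →ᵇ ℂ)} (hS : ∀ f g c, ‖S f c - S g c‖ ≤ L * ‖f c - g c‖)
    {z w : ℂ} {u v : ℂ →ᵇ ℂ} (hu : u = S (algebraMap ℂ _ z + P u))
    (hv : v = S (algebraMap ℂ _ w + P v)) {c : ℂ} (hc : z + P u c = w + P v c) : z = w := by
  have hG : ∀ c, (z - w) + P (u - v) c = (z + P u c) - (w + P v c) := by
    intro c
    rw [map_sub, BoundedContinuousFunction.sub_apply]
    ring
  have h1 : ∀ c, ‖(u - v) c‖ ≤ L * ‖(z - w) + P (u - v) c‖ := by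
    intro c
    have h2 := hS (algebraMap ℂ _ z + P u) (algebraMap ℂ _ w + P v) c
    rw [← hu, ← hv] at h2
    rw [hG]
    simpa using h2
  have h3 := norm_const_le_of_norm_le P hP hL h1 c
  rw [hG, hc, sub_self, norm_zero, mul_zero, norm_le_zero_iff, sub_eq_zero] at h3
  exact h3

theorem dbar_eq_zero_of_differentiableAt {ψ : ℂ → ℂ} {c : ℂ} (h : DifferentiableAt ℂ ψ c) :
    dbar ψ c = 0 := by
  have h1 : fderiv ℝ ψ c = (fderiv ℂ ψ c).restrictScalars ℝ :=
    (h.hasFDerivAt.restrictScalars ℝ).fderiv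
  have h2 : fderiv ℂ ψ c Complex.I = Complex.I * fderiv ℂ ψ c 1 := by
    rw [← smul_eq_mul, ← map_smul, smul_eq_mul, mul_one]
  rw [dbar, h1, ContinuousLinearMap.coe_restrictScalars', h2, ← mul_assoc, Complex.I_mul_I]
  ring

theorem continuous_dbar {ψ : ℂ → ℂ} (hψ : ContDiff ℝ 1 ψ) : Continuous (dbar ψ) := by
  have : Continuous (fderiv ℝ ψ) := hψ.continuous_fderiv one_ne_zero
  unfold dbar
  fun_prop

theorem support_dbar_subset (ψ : ℂ → ℂ) : Function.support (dbar ψ) ⊆ tsupport ψ := by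
  intro c hc
  by_contra h
  have : fderiv ℝ ψ c = 0 := image_eq_zero_of_notMem_tsupport fun h' =>
    h (tsupport_fderiv_subset ℝ h')
  exact hc (by simp [dbar, this])

theorem exists_lipschitz_interpolation {ι : Type*} (s : Finset ι) (φ U : ι → ℂ →ᵇ ℂ) {d : ℝ}
    (hd : 0 < d) (hsep : ∀ i ∈ s, ∀ j ∈ s, i ≠ j → ∀ c, d ≤ ‖φ i c - φ j c‖) :
    ∃ S : (ℂ →ᵇ ℂ) → (ℂ →ᵇ ℂ), ∃ L, 0 ≤ L ∧
      (∀ f g c, ‖S f c - S g c‖ ≤ L * ‖f c - g c‖) ∧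
      (∀ i ∈ s, S (φ i) = U i) ∧
      ∀ f c, (∀ i ∈ s, U i c = 0) → S f c = 0 := by
  let ℓ : ι → (ℂ →ᵇ ℂ) → ℂ → ℝ := fun i f c => max 0 (1 - ‖f c - φ i c‖ / d)
  have hℓ : ∀ i f, Continuous fun c => (ℓ i f c : ℂ) := fun i f => by fun_prop
  have hℓ1 : ∀ i f c, ‖(ℓ i f c : ℂ)‖ ≤ 1 := by
    intro i f c
    rw [Complex.norm_real, Real.norm_of_nonneg (le_max_left _ _)]
    exact max_le zero_le_one (sub_le_self _ (by positivity))
  let Λ : ι → (ℂ →ᵇ ℂ) → (ℂ →ᵇ ℂ) := fun i f =>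
    BoundedContinuousFunction.ofNormedAddCommGroup _ (hℓ i f) 1 (hℓ1 i f)
  have hΛ : ∀ i f c, Λ i f c = (ℓ i f c : ℂ) := fun _ _ _ => rfl
  have hΛL : ∀ i f g c, ‖Λ i f c - Λ i g c‖ ≤ d⁻¹ * ‖f c - g c‖ := by
    intro i f g c
    rw [hΛ, hΛ, ← Complex.ofReal_sub, Complex.norm_real, Real.norm_eq_abs]
    refine (abs_max_sub_max_le_max _ _ _ _).trans ?_
    rw [sub_self, abs_zero, max_eq_right (abs_nonneg _), sub_sub_sub_cancel_left, ← sub_div,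
      abs_div, abs_of_pos hd, div_eq_inv_mul]
    gcongr
    refine (abs_norm_sub_norm_le _ _).trans (le_of_eq ?_)
    rw [sub_sub_sub_cancel_right, norm_sub_rev]
  refine ⟨fun f => ∑ i ∈ s, Λ i f * U i, ∑ i ∈ s, d⁻¹ * ‖U i‖,
    Finset.sum_nonneg fun i _ => by positivity, fun f g c => ?_, fun i hi => ?_, fun f c h => ?_⟩
  · rw [BoundedContinuousFunction.sum_apply, BoundedContinuousFunction.sum_apply,
      ← Finset.sum_sub_distrib, Finset.sum_mul]
    refine norm_sum_le_of_le _ fun i _ => ?_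
    rw [BoundedContinuousFunction.mul_apply, BoundedContinuousFunction.mul_apply, ← sub_mul,
      norm_mul, mul_right_comm]
    exact mul_le_mul (hΛL i f g c) ((U i).norm_coe_le_norm c) (norm_nonneg _) (by positivity)
  · ext c
    rw [BoundedContinuousFunction.sum_apply, Finset.sum_eq_single_of_mem i hi]
    · rw [BoundedContinuousFunction.mul_apply, hΛ]
      simp [ℓ]
    · intro j hj hji
      have : ℓ j (φ i) c = 0 := by
        refine max_eq_left ?_
        have := (one_le_div hd).mpr (hsep i hi j hj hji.symm c)
        linarith
      rw [BoundedContinuousFunction.mul_apply, hΛ, this, Complex.ofReal_zero, zero_mul]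
  · rw [BoundedContinuousFunction.sum_apply]
    refine Finset.sum_eq_zero fun i hi => ?_
    rw [BoundedContinuousFunction.mul_apply, h i hi, mul_zero]

theorem IsHolomorphicMotion.exists_separation {E : Set ℂ} (hE : E.Finite) {h : ℂ → ℂ → ℂ}
    {R : ℝ} (hmot : IsHolomorphicMotion R E h) {ρ : ℝ} (hρ : ρ < R) :
    ∃ d, 0 < d ∧ ∀ c ∈ Metric.closedBall (0 : ℂ) ρ, ∀ z ∈ E, ∀ w ∈ E, z ≠ w →
      d ≤ ‖h c z - h c w‖ := by
  have hsub : Metric.closedBall (0 : ℂ) ρ ⊆ Metric.ball 0 R := Metric.closedBall_subset_ball hρ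
  have hpair : ∀ p ∈ E.offDiag, ∀ᶠ d in 𝓝[>] (0 : ℝ), ∀ c ∈ Metric.closedBall (0 : ℂ) ρ,
      d ≤ ‖h c p.1 - h c p.2‖ := by
    rintro ⟨z, w⟩ ⟨hz, hw, hzw⟩
    have hcont : ContinuousOn (fun c => ‖h c z - h c w‖) (Metric.closedBall 0 ρ) :=
      (((hmot.2.2 z hz).continuousOn.sub (hmot.2.2 w hw).continuousOn).mono hsub).norm
    obtain ⟨m, hm0, hm⟩ := (isCompact_closedBall (0 : ℂ) ρ).exists_forall_le' hcont (a := 0)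
      fun c hc => norm_pos_iff.mpr
        (sub_ne_zero.mpr fun heq => hzw (hmot.2.1 c (hsub hc) hz hw heq))
    filter_upwards [Ioo_mem_nhdsGT hm0] with d hd c hc using hd.2.le.trans (hm c hc)
  obtain ⟨d, hd, hd0⟩ := (((Filter.eventually_all_finite hE.offDiag).mpr hpair).and
    self_mem_nhdsWithin).exists
  exact ⟨d, hd0, fun c hc z hz w hw hzw => hd (z, w) ⟨hz, hw, hzw⟩ c hc⟩

/-- A holomorphic motion of a finite set `E ⊆ ℂ` parametrized by the unit
disk extends, for every `0 < r < 1`, to a holomorphic motion of all of `ℂ` parametrized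
by the disk `Δ_r`. -/
theorem holomorphicMotion_finite_extension
    (E : Set ℂ) (hE : E.Finite) (h : ℂ → ℂ → ℂ)
    (hmot : IsHolomorphicMotion 1 E h)
    (r : ℝ) (hr0 : 0 < r) (hr1 : r < 1) :
    ∃ H : ℂ → ℂ → ℂ, IsHolomorphicMotion r Set.univ H ∧
      ∀ c ∈ Metric.ball (0 : ℂ) r, ∀ z ∈ E, H c z = h c z := by
  obtain ⟨ρ, hrρ, hρ1⟩ := exists_between hr1
  let b : ContDiffBump (0 : ℂ) := ⟨r, ρ, hr0, hrρ⟩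
  let χ : ContDiffBump (0 : ℂ) := ⟨1, 2, one_pos, one_lt_two⟩
  let τ : ℂ → ℂ := fun c => b c • c
  have hτ : ContDiff ℝ 1 τ := b.contDiff.smul contDiff_id
  have hτρ : ∀ c, τ c ∈ Metric.closedBall (0 : ℂ) ρ := by
    intro c
    rw [mem_closedBall_zero_iff, norm_smul, Real.norm_of_nonneg b.nonneg]
    by_cases hc : ρ ≤ dist c 0
    · rw [b.zero_of_le_dist hc, zero_mul]
      exact (hr0.trans hrρ).le
    · rw [dist_zero_right, not_le] at hc
      exact (mul_le_of_le_one_left (norm_nonneg _) b.le_one).trans hc.le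
  have hτr : ∀ c ∈ Metric.ball (0 : ℂ) r, τ c = c := by
    intro c hc
    simp only [τ]
    rw [b.one_of_mem_closedBall (Metric.ball_subset_closedBall hc), one_smul]
  have hτ1 : ∀ c, τ c ∈ Metric.ball (0 : ℂ) 1 := fun c =>
    Metric.closedBall_subset_ball hρ1 (hτρ c)
  let ψ : ℂ → ℂ → ℂ := fun z c => h (τ c) z - z
  have hψ : ∀ z ∈ E, ContDiff ℝ 1 (ψ z) := by
    intro z hz
    have h1 : ContDiffOn ℝ 1 (fun c => h c z) (Metric.ball 0 1) :=
      ((hmot.2.2 z hz).contDiffOn Metric.isOpen_ball).restrict_scalars ℝ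
    exact (h1.comp_contDiff hτ hτ1).sub contDiff_const
  have hψsupp : ∀ z ∈ E, tsupport (ψ z) ⊆ Metric.closedBall 0 ρ := by
    intro z hz
    refine closure_minimal (fun c hc => ?_) Metric.isClosed_closedBall
    by_contra hcρ
    rw [Metric.mem_closedBall, not_le] at hcρ
    refine hc ?_
    simp only [ψ, τ]
    rw [b.zero_of_le_dist hcρ.le, zero_smul, hmot.1 z hz, sub_self]
  have hψc : ∀ z ∈ E, HasCompactSupport (ψ z) := fun z hz =>
    HasCompactSupport.of_support_subset_isCompact (isCompact_closedBall 0 ρ)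
      ((subset_tsupport _).trans (hψsupp z hz))
  have hψ0 : ∀ z ∈ E, ψ z 0 = 0 := by
    intro z hz
    simp only [ψ, τ, smul_zero]
    rw [hmot.1 z hz, sub_self]
  have hdz : ∀ z ∈ E, ∀ c ∈ Metric.ball (0 : ℂ) r, dbar (ψ z) c = 0 := by
    intro z hz c hc
    refine dbar_eq_zero_of_differentiableAt ?_
    have h1 : DifferentiableAt ℂ (fun c => h c z - z) c :=
      ((hmot.2.2 z hz).differentiableAt (Metric.isOpen_ball.mem_nhds
        (Metric.ball_subset_ball hr1.le hc))).sub_const z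
    refine h1.congr_of_eventuallyEq ?_
    filter_upwards [Metric.isOpen_ball.mem_nhds hc] with x hx
    simp only [ψ]
    rw [hτr x hx]
  have hχdbar : ∀ z ∈ E, ∀ c, (χ c : ℂ) * dbar (ψ z) c = dbar (ψ z) c := by
    intro z hz c
    by_cases hc : dbar (ψ z) c = 0
    · rw [hc, mul_zero]
    · have h1 := hψsupp z hz (support_dbar_subset _ hc)
      rw [χ.one_of_mem_closedBall (Metric.closedBall_subset_closedBall hρ1.le h1),
        Complex.ofReal_one, one_mul]
  have hχ : Continuous fun c => (χ c : ℂ) := Complex.continuous_ofReal.comp χ.continuous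
  have hχc : HasCompactSupport fun c => (χ c : ℂ) :=
    χ.hasCompactSupport.comp_left (g := fun x : ℝ => (x : ℂ)) Complex.ofReal_zero
  obtain ⟨P, hPint, hP⟩ := exists_normalized_cauchyOperator hχ hχc
  have hU : ∀ z : ℂ, ∃ U : ℂ →ᵇ ℂ, z ∈ E → ∀ c, U c = dbar (ψ z) c := by
    intro z
    by_cases hz : z ∈ E
    · have h1 := continuous_dbar (hψ z hz)
      obtain ⟨C, hC⟩ := (HasCompactSupport.of_support_subset_isCompact (hψc z hz)
        (support_dbar_subset (ψ z))).exists_bound_of_continuous h1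
      exact ⟨BoundedContinuousFunction.ofNormedAddCommGroup _ h1 C hC, fun _ _ => rfl⟩
    · exact ⟨0, fun hz' => absurd hz' hz⟩
  choose U hU using hU
  have hPU : ∀ z ∈ E, ∀ c, P (U z) c = ψ z c := by
    intro z hz c
    rw [hPint]
    simp only [hU z hz, hχdbar z hz]
    rw [integral_dbar_mul_cauchyKernel (hψ z hz) (hψc z hz),
      integral_dbar_mul_cauchyKernel (hψ z hz) (hψc z hz), hψ0 z hz, sub_zero]
  let φ : ℂ → ℂ →ᵇ ℂ := fun z => algebraMap ℂ _ z + P (U z)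
  have hφ : ∀ z ∈ E, ∀ c, φ z c = h (τ c) z := by
    intro z hz c
    have : φ z c = z + P (U z) c := by simp [φ]
    rw [this, hPU z hz]
    exact add_sub_cancel _ _
  obtain ⟨d, hd0, hd⟩ := hmot.exists_separation hE hρ1
  obtain ⟨S, L, hL, hS, hSU, hS0⟩ := exists_lipschitz_interpolation hE.toFinset φ U hd0
    (fun z hz w hw hzw c => by
      rw [Set.Finite.mem_toFinset] at hz hw
      rw [hφ z hz, hφ w hw]
      exact hd _ (hτρ c) z hz w hw hzw)
  choose u hu using exists_eq_comp_const_add P hP hL S hS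
  have hP0 : ∀ v, P v 0 = 0 := fun v => by rw [hPint, sub_self]
  refine ⟨fun c z => z + P (u z) c, ⟨fun z _ => ?_, fun c _ z _ w _ hzw => ?_, fun z _ => ?_⟩,
    fun c hc z hz => ?_⟩
  · simp only [hP0, add_zero]
  · exact eq_of_solutions_meet P hP hL hS (hu z) (hu w) hzw
  · have hu0 : ∀ c ∈ Metric.ball (0 : ℂ) r, (χ c : ℂ) * u z c = 0 := by
      intro c hc
      rw [hu z, hS0 _ c fun i hi => ?_, mul_zero]
      rw [Set.Finite.mem_toFinset] at hi
      rw [hU i hi, hdz i hi c hc]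
    simp only [hPint]
    exact ((differentiableOn_integral_mul_cauchyKernel (hχ.mul (u z).continuous)
      hχc.mul_right hu0).sub_const _).const_add z
  · have h1 : U z = S (algebraMap ℂ _ z + P (U z)) := (hSU z (hE.mem_toFinset.mpr hz)).symm
    have h2 := operator_eq_of_solutions P hP hL hS (hu z) h1
    simp only [h2, hPU z hz, ψ, hτr c hc]
    exact add_sub_cancel _ _
end

section
/- Let h : Δ × ℂ → ℂ be a holomorphic motion of ℂ parametrized by Δ with base point 0. Then for each c₀ ∈ Δ there exists a constant K ≥ 1 such that for every a ∈ ℂ and all z₁, z₂ ∈ ℂ with |z₁ − a| = |z₂ − a| > 0, one has |h(c₀, z₁) − h(c₀, a)| ≤ K |h(c₀, z₂) − h(c₀, a)|. In particular, for each c₀ ∈ Δ, limsup_{r → 0} sup_{a ∈ ℂ} (sup_{|z−a|=r} |h(c₀, z) − h(c₀, a)|) / (inf_{|z−a|=r} |h(c₀, z) − h(c₀, a)|) < ∞, i.e. the map z ↦ h(c₀, z) is quasiconformal. -/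
open Complex Metric Set in
/-- A nonvanishing holomorphic function on a disk has a holomorphic logarithm. -/
theorem exists_log_of_differentiableOn_ball {f : ℂ → ℂ} {c : ℂ} {r : ℝ}
    (hf : DifferentiableOn ℂ f (ball c r)) (h0 : ∀ z ∈ ball c r, f z ≠ 0) :
    ∃ g : ℂ → ℂ, DifferentiableOn ℂ g (ball c r) ∧ ∀ z ∈ ball c r, exp (g z) = f z := by
  rcases le_or_gt r 0 with hr | hr
  · exact ⟨f, hf, fun z hz => by simp [ball_eq_empty.2 hr] at hz⟩
  have hq : DifferentiableOn ℂ (fun z => deriv f z / f z) (ball c r) :=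
    (hf.deriv isOpen_ball).div hf h0
  obtain ⟨g, hgc, hg⟩ := hq.isExactOn_ball.with_val_at c (log (f c))
  have hc : c ∈ ball c r := mem_ball_self hr
  have hd : ∀ z ∈ ball c r, HasDerivAt (fun z => f z * exp (-g z)) 0 z := fun z hz => by
    have h1 := ((hf.differentiableAt (isOpen_ball.mem_nhds hz)).hasDerivAt).mul (hg z hz).neg.cexp
    refine h1.congr_deriv ?_
    have := h0 z hz
    field_simp
    ring
  refine ⟨g, fun z hz => (hg z hz).differentiableAt.differentiableWithinAt, fun z hz => ?_⟩
  have hconst : f z * exp (-g z) = f c * exp (-g c) :=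
    isOpen_ball.is_const_of_deriv_eq_zero (convex_ball c r).isPreconnected
      (fun w hw => (hd w hw).differentiableAt.differentiableWithinAt)
      (fun w hw => (hd w hw).deriv) hz hc
  rw [hgc, exp_neg, exp_neg, exp_log (h0 c hc), mul_inv_cancel₀ (h0 c hc)] at hconst
  exact ((mul_inv_eq_one₀ (exp_ne_zero _)).1 hconst).symm

open Complex Metric Set in
/-- **Bloch's theorem**, with a non-optimal constant. -/
theorem exists_ball_subset_image_closedBall {f : ℂ → ℂ} {U : Set ℂ} (hU : IsOpen U)
    (hf : DifferentiableOn ℂ f U) {z₀ : ℂ} {R : ℝ} (hR : 0 < R) (hsub : closedBall z₀ R ⊆ U) :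
    ∃ w : ℂ, ball w (R * ‖deriv f z₀‖ / 48) ⊆ f '' closedBall z₀ R := by
  by_cases h0 : deriv f z₀ = 0
  · exact ⟨0, by simp [h0]⟩
  have hd : DifferentiableOn ℂ (deriv f) U := hf.deriv hU
  have hcont : ContinuousOn (fun z => ‖deriv f z‖ * (R - dist z z₀)) (closedBall z₀ R) :=
    (hd.continuousOn.mono hsub).norm.mul (by fun_prop)
  obtain ⟨p, hp, hmax⟩ := (isCompact_closedBall z₀ R).exists_isMaxOn
    ⟨z₀, mem_closedBall_self hR.le⟩ hcont
  have hmax : ∀ z ∈ closedBall z₀ R,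
      ‖deriv f z‖ * (R - dist z z₀) ≤ ‖deriv f p‖ * (R - dist p z₀) := fun z hz => hmax hz
  obtain ⟨t, ht⟩ : ∃ t, t = R - dist p z₀ := ⟨_, rfl⟩
  obtain ⟨m, hm⟩ : ∃ m, m = ‖deriv f p‖ := ⟨_, rfl⟩
  rw [← ht, ← hm] at hmax
  have hmt : R * ‖deriv f z₀‖ ≤ m * t := by
    have := hmax z₀ (mem_closedBall_self hR.le)
    rw [dist_self] at this
    linarith
  have hmt0 : 0 < m * t := lt_of_lt_of_le (mul_pos hR (norm_pos_iff.2 h0)) hmt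
  have hm0 : 0 < m := by
    refine lt_of_le_of_ne (hm ▸ norm_nonneg _) fun h => ?_
    simp [← h] at hmt0
  have ht0 : 0 < t := pos_of_mul_pos_right hmt0 hm0.le
  have hin : ∀ z, dist z p ≤ t → z ∈ closedBall z₀ R := fun z hz => by
    have := dist_triangle z p z₀
    exact mem_closedBall.2 (by linarith)
  have hbd : ∀ z, dist z p < t / 2 → ‖deriv f z‖ ≤ 2 * m := fun z hz => by
    have h1 := hmax z (hin z (by linarith))
    have h2 : t / 2 ≤ R - dist z z₀ := by
      have := dist_triangle z p z₀
      linarith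
    have h3 := mul_le_mul_of_nonneg_left h2 (norm_nonneg (deriv f z))
    have h4 : ‖deriv f z‖ * t ≤ 2 * m * t := by linarith
    exact le_of_mul_le_mul_right h4 ht0
  have hmaps : MapsTo (deriv f) (ball p (t / 2)) (closedBall (deriv f p) (3 * m)) := by
    intro z hz
    rw [mem_closedBall, dist_eq_norm]
    have := norm_sub_le (deriv f z) (deriv f p)
    have := hbd z hz
    linarith
  have hder : ∀ z ∈ closedBall p (t / 12), ‖deriv f z - deriv f p‖ ≤ m / 2 := fun z hz => by
    rw [mem_closedBall] at hz
    have h1 := dist_le_div_mul_dist_of_mapsTo_ball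
      (hd.mono fun w hw => hsub (hin w (by rw [mem_ball] at hw; linarith))) hmaps
      (z := z) (mem_ball.2 (by linarith))
    rw [dist_eq_norm] at h1
    refine h1.trans ((mul_le_mul_of_nonneg_left hz (by positivity)).trans_eq ?_)
    field_simp
    norm_num
  have hfd : ∀ z ∈ closedBall p (t / 12), DifferentiableAt ℂ f z := fun z hz =>
    hf.differentiableAt (hU.mem_nhds (hsub (hin z (by rw [mem_closedBall] at hz; linarith))))
  have hlow : ∀ z ∈ sphere p (t / 12), m * t / 24 ≤ ‖f z - f p‖ := fun z hz => by
    have hlip : ‖(f z - deriv f p * z) - (f p - deriv f p * p)‖ ≤ m / 2 * ‖z - p‖ := by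
      refine (convex_closedBall p (t / 12)).norm_image_sub_le_of_norm_hasDerivWithin_le
        (f := fun z => f z - deriv f p * z) (f' := fun z => deriv f z - deriv f p)
        (fun w hw => ?_) hder (mem_closedBall_self (by positivity)) (sphere_subset_closedBall hz)
      have := (hfd w hw).hasDerivAt.sub ((hasDerivAt_id w).const_mul (deriv f p))
      simpa [Pi.sub_def] using this.hasDerivWithinAt
    have hzp : ‖z - p‖ = t / 12 := by simpa [dist_eq_norm] using hz
    have h2 : ‖deriv f p * (z - p)‖ = m * (t / 12) := by rw [norm_mul, hzp, hm]
    have h3 : deriv f p * (z - p) =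
        (f z - f p) - ((f z - deriv f p * z) - (f p - deriv f p * p)) := by ring
    have h4 := norm_sub_le (f z - f p) ((f z - deriv f p * z) - (f p - deriv f p * p))
    rw [← h3, h2] at h4
    rw [hzp] at hlip
    linarith
  have hne : ∃ᶠ z in nhds p, f z ≠ f p := by
    intro hev
    have h1 : f =ᶠ[nhds p] fun _ => f p := hev.mono fun z hz => not_not.1 hz
    have h2 := h1.deriv_eq
    rw [deriv_const] at h2
    rw [h2, norm_zero] at hm
    exact hm0.ne' hm
  have hdc : DiffContOnCl ℂ f (ball p (t / 12)) := by
    refine DifferentiableOn.diffContOnCl fun z hz => ?_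
    exact (hfd z (closure_ball_subset_closedBall hz)).differentiableWithinAt
  refine ⟨f p, (ball_subset_ball (by linarith)).trans
    ((hdc.ball_subset_image_closedBall (by positivity) hlow hne).trans
      (image_mono fun z hz => hin z ?_))⟩
  rw [mem_closedBall] at hz
  linarith

/-- The points at which `cosh ^ 2` is an integer form a net in the plane. -/
theorem exists_cosh_sq_eq_intCast (w : ℂ) :
    ∃ p ∈ Metric.ball w 2, ∃ n : ℤ, Complex.cosh p ^ 2 = n := by
  obtain ⟨k, hk1, hk2⟩ : ∃ k : ℕ, (k : ℝ) ≤ Real.sinh |w.re| ^ 2 ∧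
      Real.sinh |w.re| ^ 2 < k + 1 :=
    ⟨_, Nat.floor_le (sq_nonneg _), Nat.lt_floor_add_one _⟩
  obtain ⟨s, hs⟩ : ∃ s, s = Real.arsinh √k := ⟨_, rfl⟩
  have hsinh : Real.sinh s = √k := by rw [hs, Real.sinh_arsinh]
  have hsq : Real.sinh s ^ 2 = k := by rw [hsinh, Real.sq_sqrt (Nat.cast_nonneg k)]
  have hs0 : 0 ≤ s := by rw [hs, Real.arsinh_nonneg_iff]; positivity
  have hx0 : 0 ≤ Real.sinh |w.re| := Real.sinh_nonneg_iff.2 (abs_nonneg _)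
  have hsx : s ≤ |w.re| := by
    rw [← Real.sinh_le_sinh, hsinh]
    exact (Real.sqrt_le_left hx0).2 hk1
  have hxs : |w.re| < s + 1 := by
    rw [← Real.sinh_lt_sinh]
    have h1 : Real.sinh |w.re| < Real.cosh s := by
      refine lt_of_pow_lt_pow_left₀ 2 (Real.cosh_pos s).le ?_
      rw [Real.cosh_sq, hsq]
      exact hk2
    have h2 : Real.cosh s ≤ Real.sinh (s + 1) := by
      rw [Real.sinh_add]
      have := Real.self_le_sinh_iff.2 zero_le_one
      have h3 := mul_le_mul_of_nonneg_left this (Real.cosh_pos s).le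
      have h4 := mul_nonneg (Real.sinh_nonneg_iff.2 hs0) (Real.cosh_pos 1).le
      linarith
    linarith
  obtain ⟨x, hx, hxs2⟩ : ∃ x : ℝ, |x - w.re| < 1 ∧ Real.sinh x ^ 2 = k := by
    rcases le_total 0 w.re with h | h
    · rw [abs_of_nonneg h] at hsx hxs
      exact ⟨s, abs_lt.2 ⟨by linarith, by linarith⟩, hsq⟩
    · rw [abs_of_nonpos h] at hsx hxs
      exact ⟨-s, abs_lt.2 ⟨by linarith, by linarith⟩, by rw [Real.sinh_neg, neg_sq, hsq]⟩
  obtain ⟨m, hm⟩ : ∃ m : ℤ, |m * (Real.pi / 2) - w.im| < 1 := by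
    refine ⟨round (w.im / (Real.pi / 2)), ?_⟩
    have hπ : (0 : ℝ) < Real.pi / 2 := by positivity
    have h1 := abs_sub_round (w.im / (Real.pi / 2))
    have h2 : (round (w.im / (Real.pi / 2)) : ℝ) * (Real.pi / 2) - w.im =
        -((w.im / (Real.pi / 2) - round (w.im / (Real.pi / 2))) * (Real.pi / 2)) := by
      field_simp
      ring
    rw [h2, abs_neg, abs_mul, abs_of_pos hπ]
    have := mul_le_mul_of_nonneg_right h1 hπ.le
    linarith [Real.pi_lt_four]
  have hcosh : Complex.cosh (x + (m * (Real.pi / 2) : ℝ) * Complex.I) ^ 2 =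
      ((2 * k + 1) * (-1) ^ m + 1) / 2 := by
    have h1 := Complex.cosh_sq (x + (m * (Real.pi / 2) : ℝ) * Complex.I)
    have h2 := Complex.cosh_two_mul (x + (m * (Real.pi / 2) : ℝ) * Complex.I)
    have h3 : 2 * ((x : ℂ) + (m * (Real.pi / 2) : ℝ) * Complex.I) =
        (2 * x : ℝ) + (m * Real.pi : ℝ) * Complex.I := by
      push_cast
      ring
    have h4 : Real.cos (m * Real.pi) = (-1) ^ m := Real.cos_int_mul_pi m
    have h5 : Real.cosh (2 * x) = 2 * k + 1 := by
      rw [Real.cosh_two_mul, Real.cosh_sq, hxs2]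
      ring
    rw [h3, Complex.cosh_add, Complex.cosh_mul_I, Complex.sinh_mul_I, ← Complex.ofReal_cos,
      ← Complex.ofReal_sin, Real.sin_int_mul_pi, h4, ← Complex.ofReal_cosh, h5] at h2
    push_cast at h1 h2 ⊢
    linear_combination (-1 / 2) * h2 + (1 / 2) * h1
  refine ⟨x + (m * (Real.pi / 2) : ℝ) * Complex.I, ?_, ?_⟩
  · rw [Metric.mem_ball, dist_eq_norm]
    refine (Complex.norm_le_abs_re_add_abs_im _).trans_lt ?_
    simp only [Complex.sub_re, Complex.add_re, Complex.ofReal_re, Complex.re_ofReal_mul,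
      Complex.I_re, mul_zero, add_zero, Complex.sub_im, Complex.add_im, Complex.ofReal_im,
      Complex.im_ofReal_mul, Complex.I_im, mul_one, zero_add]
    linarith
  · rw [hcosh]
    rcases Int.even_or_odd m with h | h
    · refine ⟨k + 1, ?_⟩
      rw [h.neg_one_zpow]
      push_cast
      ring
    · refine ⟨-k, ?_⟩
      rw [h.neg_one_zpow]
      push_cast
      ring

open Complex Metric in
/-- A holomorphic function on the unit disk omitting `0` and `1` and unimodular at the origin is
`exp (2πi cosh² G)`, with control on `G` at the origin. -/
theorem exists_eq_exp_cosh_sq {f : ℂ → ℂ} (hf : DifferentiableOn ℂ f (ball 0 1))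
    (h0 : ∀ z ∈ ball (0 : ℂ) 1, f z ≠ 0) (h1 : ∀ z ∈ ball (0 : ℂ) 1, f z ≠ 1)
    (hf0 : ‖f 0‖ = 1) :
    ∃ G : ℂ → ℂ, DifferentiableOn ℂ G (ball 0 1) ∧ |(G 0).re| ≤ Real.log 2 ∧
      ∀ z ∈ ball (0 : ℂ) 1, f z = exp (2 * Real.pi * I * cosh (G z) ^ 2) := by
  obtain ⟨g, hg, hgf⟩ := exists_log_of_differentiableOn_ball hf h0
  have hz : (0 : ℂ) ∈ ball (0 : ℂ) 1 := mem_ball_self one_pos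
  have hgre : (g 0).re = 0 := by
    rw [← hgf 0 hz, norm_exp] at hf0
    exact Real.exp_eq_one_iff _ |>.1 hf0
  obtain ⟨F, hF, hFf, x, hx0, hx1, hFx⟩ : ∃ F : ℂ → ℂ, DifferentiableOn ℂ F (ball 0 1) ∧
      (∀ z ∈ ball (0 : ℂ) 1, exp (2 * Real.pi * I * F z) = f z) ∧
      ∃ x : ℝ, 0 ≤ x ∧ x ≤ 1 ∧ F 0 = x := by
    refine ⟨fun z => g z / (2 * Real.pi * I) - ⌊(g 0).im / (2 * Real.pi)⌋,
      (hg.div_const _).sub_const _, fun z hz => ?_,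
      Int.fract ((g 0).im / (2 * Real.pi)), Int.fract_nonneg _, (Int.fract_lt_one _).le, ?_⟩
    · rw [mul_sub, mul_div_cancel₀ _ two_pi_I_ne_zero, exp_sub, hgf z hz,
        mul_comm _ (Int.cast _), exp_int_mul_two_pi_mul_I, div_one]
    · have hg0 : g 0 = (g 0).im * I := by
        conv_lhs => rw [← re_add_im (g 0), hgre]
        simp
      rw [Int.fract]
      push_cast
      congr 1
      have := I_ne_zero
      field_simp
      rw [mul_comm, ← hg0]
  have hF0 : ∀ z ∈ ball (0 : ℂ) 1, F z ≠ 0 := fun z hz h => h1 z hz (by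
    rw [← hFf z hz, h, mul_zero, exp_zero])
  have hF1 : ∀ z ∈ ball (0 : ℂ) 1, F z - 1 ≠ 0 := fun z hz h => h1 z hz (by
    rw [← hFf z hz, sub_eq_zero.1 h, mul_one, exp_two_pi_mul_I])
  obtain ⟨u, hu, huF⟩ := exists_log_of_differentiableOn_ball hF hF0
  obtain ⟨v, hv, hvF⟩ := exists_log_of_differentiableOn_ball (hF.sub_const 1) hF1
  have hsqU : ∀ z ∈ ball (0 : ℂ) 1, exp (u z / 2) ^ 2 = F z := fun z hz => by
    rw [← exp_nat_mul, ← huF z hz]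
    congr 1
    push_cast
    ring
  have hsqV : ∀ z ∈ ball (0 : ℂ) 1, exp (v z / 2) ^ 2 = F z - 1 := fun z hz => by
    rw [← exp_nat_mul, ← hvF z hz]
    congr 1
    push_cast
    ring
  have hprod : ∀ z ∈ ball (0 : ℂ) 1,
      (exp (u z / 2) + exp (v z / 2)) * (exp (u z / 2) - exp (v z / 2)) = 1 := fun z hz => by
    linear_combination hsqU z hz - hsqV z hz
  obtain ⟨G, hG, hGe⟩ := exists_log_of_differentiableOn_ball
    (f := fun z => exp (u z / 2) + exp (v z / 2)) ((hu.div_const 2).cexp.add (hv.div_const 2).cexp)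
    (fun z hz => left_ne_zero_of_mul_eq_one (hprod z hz))
  have hGn : ∀ z ∈ ball (0 : ℂ) 1, exp (-G z) = exp (u z / 2) - exp (v z / 2) := fun z hz => by
    rw [exp_neg, hGe z hz]
    exact inv_eq_of_mul_eq_one_right (hprod z hz)
  refine ⟨G, hG, ?_, fun z hz => ?_⟩
  · have hU : ‖exp (u 0 / 2)‖ ≤ 1 := by
      refine (sq_le_one_iff₀ (norm_nonneg _)).1 ?_
      rw [← norm_pow, hsqU 0 hz, hFx, norm_real, Real.norm_eq_abs, abs_of_nonneg hx0]
      exact hx1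
    have hV : ‖exp (v 0 / 2)‖ ≤ 1 := by
      refine (sq_le_one_iff₀ (norm_nonneg _)).1 ?_
      rw [← norm_pow, hsqV 0 hz, hFx, ← ofReal_one, ← ofReal_sub, norm_real, Real.norm_eq_abs,
        abs_le]
      constructor <;> linarith
    have e1 : Real.exp (G 0).re ≤ 2 := by
      rw [← norm_exp, hGe 0 hz]
      exact (norm_add_le _ _).trans (by linarith)
    have e2 : Real.exp (-(G 0).re) ≤ 2 := by
      rw [← neg_re, ← norm_exp, hGn 0 hz]
      exact (norm_sub_le _ _).trans (by linarith)
    rw [abs_le']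
    exact ⟨(Real.le_log_iff_exp_le two_pos).2 e1, (Real.le_log_iff_exp_le two_pos).2 e2⟩
  · have : cosh (G z) = exp (u z / 2) := by
      rw [cosh, hGe z hz, hGn z hz]
      ring
    rw [this, hsqU z hz, hFf z hz]

open Complex Metric in
/-- **Schottky's theorem** for functions that are unimodular at the origin. -/
theorem exists_norm_le_of_ne_zero_of_ne_one {ρ : ℝ} (hρ0 : 0 ≤ ρ) (hρ : ρ < 1) :
    ∃ K : ℝ, 1 ≤ K ∧ ∀ f : ℂ → ℂ, DifferentiableOn ℂ f (ball 0 1) →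
      (∀ z ∈ ball (0 : ℂ) 1, f z ≠ 0) → (∀ z ∈ ball (0 : ℂ) 1, f z ≠ 1) → ‖f 0‖ = 1 →
      ∀ z ∈ closedBall (0 : ℂ) ρ, ‖f z‖ ≤ K := by
  obtain ⟨R, hR⟩ : ∃ R, R = (1 - ρ) / 2 := ⟨_, rfl⟩
  have hR0 : 0 < R := by linarith
  refine ⟨Real.exp (2 * Real.pi * Real.exp (Real.log 2 + 96 / R * ρ) ^ 2),
    Real.one_le_exp (by positivity), fun f hf h0 h1 hf0 z hz => ?_⟩
  obtain ⟨G, hG, hGre, hGf⟩ := exists_eq_exp_cosh_sq hf h0 h1 hf0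
  have hsub : closedBall (0 : ℂ) ρ ⊆ ball 0 1 := closedBall_subset_ball hρ
  have hder : ∀ w ∈ closedBall (0 : ℂ) ρ, ‖deriv G w‖ ≤ 96 / R := fun w hw => by
    have hwsub : closedBall w R ⊆ ball (0 : ℂ) 1 := by
      refine closedBall_subset_ball' ?_
      rw [mem_closedBall] at hw
      linarith
    obtain ⟨q, hq⟩ := exists_ball_subset_image_closedBall isOpen_ball hG hR0 hwsub
    by_contra! hlt
    obtain ⟨p, hp, n, hn⟩ := exists_cosh_sq_eq_intCast q
    have hrad : (2 : ℝ) ≤ R * ‖deriv G w‖ / 48 := by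
      rw [div_lt_iff₀ hR0] at hlt
      linarith
    obtain ⟨y, hy, rfl⟩ := hq (ball_subset_ball hrad hp)
    refine h1 y (hwsub hy) ?_
    rw [hGf y (hwsub hy), hn, mul_comm, exp_int_mul_two_pi_mul_I]
  have hdiff : ‖G z - G 0‖ ≤ 96 / R * ρ := by
    have := (convex_closedBall (0 : ℂ) ρ).norm_image_sub_le_of_norm_deriv_le
      (fun w hw => hG.differentiableAt (isOpen_ball.mem_nhds (hsub hw))) hder
      (mem_closedBall_self hρ0) hz
    refine this.trans (mul_le_mul_of_nonneg_left ?_ (by positivity))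
    simpa using hz
  have hre : |(G z).re| ≤ Real.log 2 + 96 / R * ρ := by
    have e1 := (abs_re_le_norm (G z - G 0)).trans hdiff
    have e2 := abs_add_le (G 0).re (G z - G 0).re
    rw [sub_re, add_sub_cancel] at e2
    rw [sub_re] at e1
    linarith
  have hcosh : ‖cosh (G z)‖ ≤ Real.exp (Real.log 2 + 96 / R * ρ) := by
    have e1 : ‖exp (G z)‖ ≤ Real.exp (Real.log 2 + 96 / R * ρ) := by
      rw [norm_exp]
      exact Real.exp_le_exp.2 ((le_abs_self _).trans hre)
    have e2 : ‖exp (-G z)‖ ≤ Real.exp (Real.log 2 + 96 / R * ρ) := by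
      rw [norm_exp, neg_re]
      exact Real.exp_le_exp.2 ((neg_le_abs _).trans hre)
    rw [cosh, norm_div, norm_ofNat]
    linarith [norm_add_le (exp (G z)) (exp (-G z))]
  rw [hGf z (hsub hz), norm_exp]
  refine Real.exp_le_exp.2 ((re_le_norm _).trans ?_)
  rw [norm_mul, norm_pow, norm_mul, norm_mul, norm_I, norm_ofNat, norm_real, Real.norm_eq_abs,
    abs_of_pos Real.pi_pos, mul_one]
  gcongr

/-- If `h` is a holomorphic motion of `ℂ` parametrized by the unit disk
with base point `0`, then for each `c₀ ∈ Δ` there is a constant `K ≥ 1` such that for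
every `a ∈ ℂ` and all `z₁, z₂` equidistant from `a` (at positive distance),
`|h(c₀,z₁) - h(c₀,a)| ≤ K |h(c₀,z₂) - h(c₀,a)|`; i.e. `z ↦ h(c₀,z)` has uniformly
bounded circular distortion, so it is quasiconformal. -/
theorem holomorphicMotion_quasiconformal
    (h : ℂ → ℂ → ℂ) (hmot : IsHolomorphicMotion 1 Set.univ h)
    (c₀ : ℂ) (hc₀ : c₀ ∈ Metric.ball (0 : ℂ) 1) :
    ∃ K : ℝ, 1 ≤ K ∧
      ∀ a z₁ z₂ : ℂ, ‖z₁ - a‖ = ‖z₂ - a‖ → 0 < ‖z₁ - a‖ →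
        ‖h c₀ z₁ - h c₀ a‖ ≤ K * ‖h c₀ z₂ - h c₀ a‖ := by
  obtain ⟨hid, hinj, hhol⟩ := hmot
  obtain ⟨K, hK, hS⟩ := exists_norm_le_of_ne_zero_of_ne_one (norm_nonneg c₀)
    (by simpa using hc₀)
  refine ⟨K, hK, fun a z₁ z₂ heq hpos => ?_⟩
  rcases eq_or_ne z₁ z₂ with rfl | hne
  · exact le_mul_of_one_le_left (norm_nonneg _) hK
  have hsep : ∀ c ∈ Metric.ball (0 : ℂ) 1, ∀ x y : ℂ, x ≠ y → h c x - h c y ≠ 0 :=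
    fun c hc x y hxy he =>
      hxy (hinj c hc (Set.mem_univ x) (Set.mem_univ y) (sub_eq_zero.1 he))
  have h1a : z₁ ≠ a := sub_ne_zero.1 (norm_pos_iff.1 hpos)
  have h2a : z₂ ≠ a := sub_ne_zero.1 (norm_pos_iff.1 (heq ▸ hpos))
  have hd : ∀ z, DifferentiableOn ℂ (fun c => h c z) (Metric.ball 0 1) :=
    fun z => hhol z (Set.mem_univ z)
  have key := hS (fun c => (h c z₁ - h c a) / (h c z₂ - h c a))
    (((hd z₁).sub (hd a)).div ((hd z₂).sub (hd a)) fun c hc => hsep c hc _ _ h2a)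
    (fun c hc => div_ne_zero (hsep c hc _ _ h1a) (hsep c hc _ _ h2a))
    (fun c hc he => by
      rw [div_eq_one_iff_eq (hsep c hc _ _ h2a)] at he
      exact hsep c hc _ _ hne (by linear_combination he))
    (by
      simp only [hid _ (Set.mem_univ _), norm_div]
      rw [heq, div_self (heq ▸ hpos).ne'])
    c₀ (by simp)
  rwa [norm_div, div_le_iff₀ (norm_pos_iff.2 (hsep c₀ hc₀ _ _ h2a))] at key
end
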